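/- arXiv:2112.11712 — 6 statements merged into one kernel-verified Lean document; each statement's English description precedes it below -/
import Mathlib

section
/- Let G be a simple graph on n vertices and let A ∈ S(G) be a matrix with the strong spectral property (SSP). Then for every integer q' with q(A) ≤ q' ≤ n, there exists a matrix A' ∈ S(G) with the SSP such that q(A') = q'. -/
open Matrix Polynomial

/-- `A` belongs to `S(G)`: symmetric, with off-diagonal nonzero pattern given by `G`. -/
def sMem {n : ℕ} (G : SimpleGraph (Fin n)) (A : Matrix (Fin n) (Fin n) ℝ) : Prop :=
  A.IsSymm ∧ ∀ i j, i ≠ j → (A i j ≠ 0 ↔ G.Adj i j)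

/-- The strong spectral property. -/
def HasSSP {n : ℕ} (A : Matrix (Fin n) (Fin n) ℝ) : Prop :=
  ∀ X : Matrix (Fin n) (Fin n) ℝ, X.IsSymm →
    (∀ i j, A i j * X i j = 0) → (∀ i, X i i = 0) → A * X = X * A → X = 0

/-- The number of distinct (real) eigenvalues of `A`. -/
noncomputable def qDist {n : ℕ} (A : Matrix (Fin n) (Fin n) ℝ) : ℕ :=
  A.charpoly.roots.toFinset.card

open Filter NormedSpace
open scoped Topology

variable {n : ℕ}

theorem charpoly_eq_of_isSymm_exp_conj_add {B K S : Matrix (Fin n) (Fin n) ℝ} (hB : B.IsSymm)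
    (hK : Kᵀ = -K) (hS : Sᵀ = -S) (hD : (exp (-K) * B * exp K + S).IsSymm) :
    B.charpoly = (exp (-K) * B * exp K + S).charpoly := by
  have hS0 : S = 0 := by
    have h := hD.eq
    rw [transpose_add, transpose_mul, transpose_mul, hB.eq, ← Matrix.exp_transpose,
      ← Matrix.exp_transpose, transpose_neg, hK, neg_neg, hS, ← mul_assoc, add_right_inj] at h
    ext i j
    exact self_eq_neg.1 (congr_fun (congr_fun h.symm i) j)
  have hU : IsUnit (exp K).det := (Matrix.isUnit_iff_isUnit_det (exp K)).1 (Matrix.isUnit_exp K)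
  rw [hS0, add_zero, Matrix.charpoly_mul_comm, ← mul_assoc, Matrix.exp_neg,
    Matrix.mul_nonsing_inv _ hU, one_mul]

open scoped Matrix.Norms.Operator

theorem hasStrictFDerivAt_exp_conj_add {E R : Type*} [NormedAddCommGroup E] [NormedSpace ℝ E]
    [NormedRing R] [NormedAlgebra ℝ R] [CompleteSpace R] (a : R) (b k s : E →L[ℝ] R) :
    ∃ F' : E →L[ℝ] R, (∀ p, F' p = b p + (a * k p - k p * a) + s p) ∧
      HasStrictFDerivAt (fun p => exp (-k p) * (a + b p) * exp (k p) + s p) F' 0 := by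
  have hexp (l : E →L[ℝ] R) : HasStrictFDerivAt (fun p => exp (l p)) l 0 := by
    have h : HasStrictFDerivAt (exp : R → R) (1 : R →L[ℝ] R) (l 0) := by
      rw [map_zero]
      exact hasStrictFDerivAt_exp_zero
    have := h.comp (0 : E) l.hasStrictFDerivAt
    simpa [Function.comp_def, ContinuousLinearMap.one_def] using this
  have h := (((hexp (-k)).mul' (b.hasStrictFDerivAt.const_add a)).mul' (hexp k)).add
    s.hasStrictFDerivAt
  refine ⟨_, fun p => ?_, h⟩
  simp
  abel

/-- The symmetric matrix supported on the diagonal and on the edges of `G` obtained from `Y`. -/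
noncomputable def edgePart (G : SimpleGraph (Fin n)) :
    Matrix (Fin n) (Fin n) ℝ →ₗ[ℝ] Matrix (Fin n) (Fin n) ℝ := by
  classical
  exact
  { toFun := fun Y => of fun i j => if i = j ∨ G.Adj i j then Y i j + Y j i else 0
    map_add' := fun Y Z => by
      ext i j
      by_cases h : i = j ∨ G.Adj i j <;> simp [h]
      abel
    map_smul' := fun c Y => by
      ext i j
      by_cases h : i = j ∨ G.Adj i j <;> simp [h]
      ring }

theorem edgePart_apply_of_mem {G : SimpleGraph (Fin n)} {i j : Fin n} (h : i = j ∨ G.Adj i j)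
    (Y : Matrix (Fin n) (Fin n) ℝ) : edgePart G Y i j = Y i j + Y j i := by
  simp [edgePart, h]

theorem edgePart_apply_of_notMem {G : SimpleGraph (Fin n)} {i j : Fin n}
    (h : ¬ (i = j ∨ G.Adj i j)) (Y : Matrix (Fin n) (Fin n) ℝ) : edgePart G Y i j = 0 := by
  simp [edgePart, h]

theorem edgePart_isSymm (G : SimpleGraph (Fin n)) (Y : Matrix (Fin n) (Fin n) ℝ) :
    (edgePart G Y).IsSymm := by
  ext i j
  have : (j = i ∨ G.Adj j i) ↔ (i = j ∨ G.Adj i j) := by rw [eq_comm, G.adj_comm]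
  by_cases h : i = j ∨ G.Adj i j
  · rw [transpose_apply, edgePart_apply_of_mem h, edgePart_apply_of_mem (this.2 h), add_comm]
  · rw [transpose_apply, edgePart_apply_of_notMem h, edgePart_apply_of_notMem (mt this.1 h)]

/-- Twice the skew-symmetric part of a square matrix. -/
def skewPart : Matrix (Fin n) (Fin n) ℝ →ₗ[ℝ] Matrix (Fin n) (Fin n) ℝ :=
  LinearMap.id - (transposeLinearEquiv (Fin n) (Fin n) ℝ ℝ).toLinearMap

@[simp] theorem skewPart_apply (Z : Matrix (Fin n) (Fin n) ℝ) : skewPart Z = Z - Zᵀ := rfl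

theorem skewPart_transpose (Z : Matrix (Fin n) (Fin n) ℝ) : (skewPart Z)ᵀ = -skewPart Z := by
  simp

/-- The strong spectral property as a transversality statement. -/
theorem HasSSP.exists_eq_add {G : SimpleGraph (Fin n)} {A : Matrix (Fin n) (Fin n) ℝ}
    (hA : sMem G A) (hssp : HasSSP A) (T : Matrix (Fin n) (Fin n) ℝ) :
    ∃ Y Z W, edgePart G Y + (A * skewPart Z - skewPart Z * A) + skewPart W = T := by
  let L₁ := edgePart G
  let L₂ := (LinearMap.mulLeft ℝ A - LinearMap.mulRight ℝ A) ∘ₗ (skewPart (n := n))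
  suffices h : L₁.range ⊔ L₂.range ⊔ (skewPart (n := n)).range = ⊤ by
    have hT : T ∈ L₁.range ⊔ L₂.range ⊔ (skewPart (n := n)).range := h ▸ Submodule.mem_top
    obtain ⟨U, hU, _, ⟨W, rfl⟩, rfl⟩ := Submodule.mem_sup.1 hT
    obtain ⟨_, ⟨Y, rfl⟩, _, ⟨Z, rfl⟩, rfl⟩ := Submodule.mem_sup.1 hU
    exact ⟨Y, Z, W, rfl⟩
  by_contra hne
  obtain ⟨f, hf0, hf⟩ := Submodule.exists_le_ker_of_lt_top _ (lt_top_iff_ne_top.2 hne)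
  simp only [sup_le_iff, LinearMap.range_le_ker_iff] at hf
  obtain ⟨⟨h₁, h₂⟩, h₃⟩ := hf
  let X : Matrix (Fin n) (Fin n) ℝ := of fun i j => f (single j i 1)
  have hfX (M) : f M = (X * M).trace := by
    conv_lhs => rw [matrix_eq_sum_single M]
    simp only [map_sum, trace, diag_apply, mul_apply]
    rw [Finset.sum_comm]
    refine Finset.sum_congr rfl fun i _ => Finset.sum_congr rfl fun j _ => ?_
    have : single j i (M j i) = M j i • single j i (1 : ℝ) := by simp
    rw [this, map_smul, smul_eq_mul, mul_comm]
    rfl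
  have hsym : X.IsSymm := by
    ext i j
    have := LinearMap.congr_fun h₃ (single i j 1)
    simp only [LinearMap.comp_apply, skewPart_apply, transpose_single, map_sub] at this
    exact sub_eq_zero.1 this
  have hX0 {i j} (h : i = j ∨ G.Adj i j) : X i j = 0 := by
    have := LinearMap.congr_fun h₁ (single i j 1)
    have hE : edgePart G (single i j 1) = single i j 1 + single j i (1 : ℝ) := by
      ext k l
      by_cases hkl : k = l ∨ G.Adj k l
      · rw [edgePart_apply_of_mem hkl, Matrix.add_apply, ← transpose_single i j (1 : ℝ), transpose_apply]
      · rw [edgePart_apply_of_notMem hkl]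
        have h1 : ¬ (i = k ∧ j = l) := by rintro ⟨rfl, rfl⟩; exact hkl h
        have h2 : ¬ (j = k ∧ i = l) := by
          rintro ⟨rfl, rfl⟩; exact hkl (h.imp Eq.symm fun h => h.symm)
        simp [h1, h2]
    simp only [L₁, LinearMap.comp_apply, hE, map_add, LinearMap.zero_apply] at this
    have h' : X j i + X i j = 0 := this
    rw [hsym.apply] at h'
    linarith
  have hcomm : A * X = X * A := by
    have hskew : (X * A - A * X)ᵀ = - (X * A - A * X) := by
      rw [transpose_sub, transpose_mul, transpose_mul, hsym.eq, hA.1.eq, neg_sub]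
    have key (Z) : ((X * A - A * X) * skewPart Z).trace = 0 := by
      have h := LinearMap.congr_fun h₂ Z
      simp only [L₂, LinearMap.comp_apply, LinearMap.zero_apply, hfX, LinearMap.sub_apply,
        LinearMap.mulLeft_apply, LinearMap.mulRight_apply] at h
      rw [← h, mul_sub, sub_mul, trace_sub, trace_sub, ← mul_assoc X (skewPart Z),
        trace_mul_comm (X * skewPart Z), mul_assoc, mul_assoc]
    ext i j
    have h := key (single i j 1)
    have h' := congr_fun (congr_fun hskew i) j
    simp only [skewPart_apply, transpose_single, mul_sub, trace_sub, trace_mul_single,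
      transpose_apply, Matrix.neg_apply, MulOpposite.op_one, one_smul] at h h'
    have e1 : (X * A - A * X) i j = (X * A) i j - (A * X) i j := rfl
    linarith
  have : X = 0 := by
    refine hssp X hsym (fun i j => ?_) (fun i => hX0 (.inl rfl)) hcomm
    by_cases h : i = j ∨ G.Adj i j
    · rw [hX0 h, mul_zero]
    · push Not at h
      rw [not_not.1 (mt (hA.2 i j h.1).1 h.2), zero_mul]
  exact hf0 (LinearMap.ext fun M => by simp [hfX, this])

/-- The strong spectral property is open among the matrices of `S(G)`. -/
theorem HasSSP.eventually {G : SimpleGraph (Fin n)} {A : Matrix (Fin n) (Fin n) ℝ}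
    (hA : sMem G A) (hssp : HasSSP A) :
    ∀ᶠ A' in 𝓝 A, sMem G A' → HasSSP A' := by
  classical
  let mask : Matrix (Fin n) (Fin n) ℝ →ₗ[ℝ] (Fin n → Fin n → ℝ) :=
    LinearMap.pi fun i => LinearMap.pi fun j =>
      (if i = j ∨ G.Adj i j then (1 : ℝ) else 0) • entryLinearMap ℝ ℝ i j
  have hmask (X) : mask X = 0 ↔ ∀ i j, (i = j ∨ G.Adj i j) → X i j = 0 := by
    simp only [funext_iff]
    refine forall₂_congr fun i j => ?_
    by_cases h : i = j ∨ G.Adj i j <;> simp [mask, h]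
  have hmask' {B : Matrix (Fin n) (Fin n) ℝ} (hB : sMem G B) (X) :
      mask X = 0 ↔ (∀ i j, B i j * X i j = 0) ∧ ∀ i, X i i = 0 := by
    rw [hmask]
    refine ⟨fun h => ⟨fun i j => ?_, fun i => h i i (.inl rfl)⟩, fun h i j hij => ?_⟩
    · by_cases hij : i = j ∨ G.Adj i j
      · rw [h i j hij, mul_zero]
      · push Not at hij
        rw [not_not.1 (mt (hB.2 i j hij.1).1 hij.2), zero_mul]
    · by_cases hne : i = j
      · exact hne ▸ h.2 i
      · exact (mul_eq_zero.1 (h.1 i j)).resolve_left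
          ((hB.2 i j hne).2 (hij.resolve_left hne))
  let L : Matrix (Fin n) (Fin n) ℝ →ₗ[ℝ]
      Matrix (Fin n) (Fin n) ℝ × Matrix (Fin n) (Fin n) ℝ × (Fin n → Fin n → ℝ) :=
    (LinearMap.mulLeft ℝ A - LinearMap.mulRight ℝ A).prod (skewPart.prod mask)
  have hL_apply (X) : L X = (A * X - X * A, X - Xᵀ, mask X) := rfl
  have hL : LinearMap.ker L = ⊥ := by
    rw [LinearMap.ker_eq_bot']
    intro X hX
    rw [hL_apply, Prod.mk_eq_zero, Prod.mk_eq_zero, sub_eq_zero, sub_eq_zero] at hX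
    obtain ⟨h1, h2, h3⟩ := hX
    obtain ⟨h4, h5⟩ := (hmask' hA X).1 h3
    exact hssp X h2.symm h4 h5 h1
  obtain ⟨K, hK, hanti⟩ := L.exists_antilipschitzWith hL
  have hK' : (0 : ℝ) < K := hK
  filter_upwards [Metric.ball_mem_nhds A (ε := 1 / (2 * K)) (by positivity)] with A' hA' hmem
  intro X hX h1 h2 h3
  have hLX : L X = ((A - A') * X - X * (A - A'), 0, 0) := by
    rw [hL_apply, hX.eq, sub_self, (hmask' hmem X).2 ⟨h1, h2⟩, sub_mul, mul_sub, h3,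
      sub_sub_sub_cancel_right]
  have hnorm : ‖L X‖ ≤ 2 * ‖A - A'‖ * ‖X‖ := by
    rw [hLX]
    simp only [Prod.norm_mk, norm_zero, max_self]
    refine max_le ?_ (by positivity)
    calc _ ≤ ‖(A - A') * X‖ + ‖X * (A - A')‖ := norm_sub_le _ _
      _ ≤ ‖A - A'‖ * ‖X‖ + ‖X‖ * ‖A - A'‖ := add_le_add (norm_mul_le _ _) (norm_mul_le _ _)
      _ = _ := by ring
  have hle : ‖X‖ ≤ K * ‖L X‖ := by
    simpa using hanti.le_mul_dist X 0
  have hlt : ‖A - A'‖ < 1 / (2 * K) := by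
    rwa [← dist_eq_norm, dist_comm]
  rw [lt_div_iff₀ (by positivity)] at hlt
  by_contra hX0
  have hpos : 0 < ‖X‖ := norm_pos_iff.2 hX0
  have : K * ‖L X‖ ≤ K * (2 * ‖A - A'‖ * ‖X‖) := by gcongr
  nlinarith

theorem sMem.eventually_add_edgePart {G : SimpleGraph (Fin n)} {A : Matrix (Fin n) (Fin n) ℝ}
    (hA : sMem G A) : ∀ᶠ Y in 𝓝 0, sMem G (A + edgePart G Y) := by
  have hcont : Continuous (edgePart G) := (edgePart G).continuous_of_finiteDimensional
  have h : ∀ᶠ Y in 𝓝 0, ∀ i j, A i j ≠ 0 → (A + edgePart G Y) i j ≠ 0 := by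
    simp only [Filter.eventually_all]
    intro i j hij
    have hc : Continuous fun Y => (A + edgePart G Y) i j :=
      (continuous_const.add hcont).matrix_elem i j
    exact hc.continuousAt.eventually_ne (by simpa using hij)
  filter_upwards [h] with Y hY
  refine ⟨hA.1.add (edgePart_isSymm G Y), fun i j hij => ⟨fun h => ?_, fun h => ?_⟩⟩
  · by_contra hadj
    refine h ?_
    rw [Matrix.add_apply, edgePart_apply_of_notMem (by tauto),
      not_not.1 (mt (hA.2 i j hij).1 hadj), add_zero]
  · exact hY i j ((hA.2 i j hij).2 h)

/-- Every symmetric matrix close enough to a matrix `A ∈ S(G)` with the strong spectral property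
is cospectral with a matrix in `S(G)` with the strong spectral property. -/
theorem HasSSP.eventually_exists_charpoly_eq {G : SimpleGraph (Fin n)}
    {A : Matrix (Fin n) (Fin n) ℝ} (hA : sMem G A) (hssp : HasSSP A) :
    ∀ᶠ D in 𝓝 A, D.IsSymm →
      ∃ A', sMem G A' ∧ HasSSP A' ∧ A'.charpoly = D.charpoly := by
  let M := Matrix (Fin n) (Fin n) ℝ
  let b : M × M × M →L[ℝ] M := (edgePart G).toContinuousLinearMap ∘L .fst ℝ M (M × M)
  let k : M × M × M →L[ℝ] M :=
    skewPart.toContinuousLinearMap ∘L .fst ℝ M M ∘L .snd ℝ M (M × M)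
  let s : M × M × M →L[ℝ] M :=
    skewPart.toContinuousLinearMap ∘L .snd ℝ M M ∘L .snd ℝ M (M × M)
  obtain ⟨F', hF', hF⟩ := hasStrictFDerivAt_exp_conj_add A b k s
  have hsurj : F'.range = ⊤ := by
    rw [LinearMap.range_eq_top]
    intro T
    obtain ⟨Y, Z, W, h⟩ := hssp.exists_eq_add hA T
    exact ⟨(Y, Z, W), (hF' _).trans h⟩
  have hmap := hF.map_nhds_eq_of_surj hsurj
  have h0 : exp (-k 0) * (A + b 0) * exp (k 0) + s 0 = A := by
    simp
  replace hmap := hmap.trans (congrArg 𝓝 h0)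
  have hY : Tendsto (fun p : M × M × M => p.1) (𝓝 0) (𝓝 0) := continuous_fst.tendsto _
  have hAb : Tendsto (fun p => A + b p) (𝓝 0) (𝓝 A) := by
    have : Continuous fun p => A + b p := by fun_prop
    simpa using this.tendsto 0
  have hN : ∀ᶠ p in 𝓝 (0 : M × M × M), sMem G (A + b p) ∧ HasSSP (A + b p) := by
    filter_upwards [hY.eventually hA.eventually_add_edgePart,
      hAb.eventually (hssp.eventually hA)] with p h1 h2
    exact ⟨h1, h2 h1⟩
  filter_upwards [hmap.ge (image_mem_map hN)]
  rintro D ⟨p, ⟨hp1, hp2⟩, rfl⟩ hD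
  exact ⟨A + b p, hp1, hp2, charpoly_eq_of_isSymm_exp_conj_add hp1.1
    (skewPart_transpose _) (skewPart_transpose _) hD⟩

theorem charpoly_roots_toFinset_of_conj_diagonal {U : Matrix (Fin n) (Fin n) ℝ}
    (hU : Uᵀ * U = 1) (d : Fin n → ℝ) :
    (U * diagonal d * Uᵀ).charpoly.roots.toFinset = Finset.univ.image d := by
  rw [Matrix.charpoly_mul_comm, ← mul_assoc, hU, one_mul, charpoly_diagonal,
    Polynomial.roots_prod _ _ (by simp [Finset.prod_ne_zero_iff, Polynomial.X_sub_C_ne_zero])]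
  ext x
  simp

theorem exists_eq_conj_diagonal {A : Matrix (Fin n) (Fin n) ℝ} (hA : A.IsSymm) :
    ∃ (U : Matrix (Fin n) (Fin n) ℝ) (d : Fin n → ℝ),
      Uᵀ * U = 1 ∧ A = U * diagonal d * Uᵀ := by
  have hH : A.IsHermitian := by
    rw [Matrix.IsHermitian, conjTranspose_eq_transpose_of_trivial]
    exact hA
  refine ⟨hH.eigenvectorUnitary, hH.eigenvalues, ?_, ?_⟩
  · have := Unitary.coe_star_mul_self hH.eigenvectorUnitary
    rwa [star_eq_conjTranspose, conjTranspose_eq_transpose_of_trivial] at this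
  · have := hH.spectral_theorem
    rwa [Unitary.conjStarAlgAut_apply, star_eq_conjTranspose,
      conjTranspose_eq_transpose_of_trivial] at this

theorem card_image_update_of_eq {d : Fin n → ℝ} {i j : Fin n} (hij : i ≠ j) (hd : d i = d j)
    {x : ℝ} (hx : x ∉ Finset.univ.image d) :
    (Finset.univ.image (Function.update d i x)).card = (Finset.univ.image d).card + 1 := by
  rw [← Finset.card_insert_of_notMem hx]
  congr 1
  ext y
  simp only [Finset.mem_image, Finset.mem_univ, true_and, Finset.mem_insert]
  constructor
  · rintro ⟨l, rfl⟩
    by_cases h : l = i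
    · left; simp [h]
    · right; exact ⟨l, by simp [h]⟩
  · rintro (rfl | ⟨l, rfl⟩)
    · exact ⟨i, by simp⟩
    · by_cases h : l = i
      · exact ⟨j, by simp [h, hij.symm, hd]⟩
      · exact ⟨l, by simp [h]⟩

theorem exists_ssp_qDist_eq_succ {G : SimpleGraph (Fin n)} {A : Matrix (Fin n) (Fin n) ℝ}
    (hA : sMem G A) (hssp : HasSSP A) (hq : qDist A < n) :
    ∃ A', sMem G A' ∧ HasSSP A' ∧ qDist A' = qDist A + 1 := by
  obtain ⟨U, d, hU, hAU⟩ := exists_eq_conj_diagonal hA.1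
  have hqA : qDist A = (Finset.univ.image d).card := by
    rw [qDist, hAU, charpoly_roots_toFinset_of_conj_diagonal hU]
  obtain ⟨i, j, hij, hd⟩ : ∃ i j, i ≠ j ∧ d i = d j := by
    by_contra! h
    have hinj : Function.Injective d := fun i j => not_imp_not.1 (h i j)
    rw [hqA, Finset.card_image_of_injective _ hinj, Finset.card_univ, Fintype.card_fin] at hq
    exact hq.false
  have hcont : Continuous fun x => U * diagonal (Function.update d i x) * Uᵀ :=
    (continuous_const.matrix_mul
      (continuous_const.update i continuous_id).matrix_diagonal).matrix_mul continuous_const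
  have hlim : Tendsto (fun x => U * diagonal (Function.update d i x) * Uᵀ) (𝓝 (d i)) (𝓝 A) := by
    have := hcont.tendsto (d i)
    rwa [Function.update_eq_self, ← hAU] at this
  have hmem : ∀ᶠ x in 𝓝[≠] (d i), x ∉ Finset.univ.image d := by
    have h := ((Finset.univ.image d).erase (d i)).finite_toSet.isClosed.isOpen_compl.mem_nhds
      (x := d i) (by simp)
    filter_upwards [mem_nhdsWithin_of_mem_nhds h, self_mem_nhdsWithin] with x h1 h2 h3
    exact h1 (Finset.mem_coe.2 (Finset.mem_erase.2 ⟨h2, h3⟩))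
  obtain ⟨x, hx, h⟩ := (hmem.and ((hlim.mono_left nhdsWithin_le_nhds).eventually
    (hssp.eventually_exists_charpoly_eq hA))).exists
  obtain ⟨A', h1, h2, h3⟩ := h (by
    rw [Matrix.IsSymm, transpose_mul, transpose_mul, transpose_transpose, diagonal_transpose,
      mul_assoc])
  refine ⟨A', h1, h2, ?_⟩
  rw [hqA, qDist, h3, charpoly_roots_toFinset_of_conj_diagonal hU,
    card_image_update_of_eq hij hd hx]

/-- Theorem 9 (SSP case): if `A ∈ S(G)` has the SSP, then every number of distinct
eigenvalues `q'` with `q(A) ≤ q' ≤ n` is realized by a matrix in `S(G)` with the SSP. -/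
theorem q_increment_ssp (n : ℕ) (G : SimpleGraph (Fin n))
    (A : Matrix (Fin n) (Fin n) ℝ) (hA : sMem G A) (hssp : HasSSP A) :
    ∀ q' : ℕ, qDist A ≤ q' → q' ≤ n →
      ∃ A' : Matrix (Fin n) (Fin n) ℝ, sMem G A' ∧ HasSSP A' ∧ qDist A' = q' := by
  intro q' hq'
  induction q', hq' using Nat.le_induction with
  | base => exact fun _ => ⟨A, hA, hssp, rfl⟩
  | succ q _ ih =>
    intro hn
    obtain ⟨B, hB, hBssp, rfl⟩ := ih (by omega)
    exact exists_ssp_qDist_eq_succ hB hBssp hn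
end

section
/- Let n ≥ 3 and let C_n be the cycle graph on n vertices. For every matrix A ∈ S(C_n) there exists a matrix A' ∈ S(C_n) with the strong multiplicity property (SMP) such that m(A') = m(A); that is, every ordered multiplicity list that can be achieved by a matrix in S(C_n) can be achieved by a matrix in S(C_n) with the SMP. -/
open Matrix Polynomial

/-- The strong multiplicity property. -/
def HasSMP {n : ℕ} (A : Matrix (Fin n) (Fin n) ℝ) : Prop :=
  ∀ X : Matrix (Fin n) (Fin n) ℝ, X.IsSymm →
    (∀ i j, A i j * X i j = 0) → (∀ i, X i i = 0) → A * X = X * A →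
    (∀ k < qDist A, Matrix.trace (A ^ k * X) = 0) → X = 0

/-- The ordered multiplicity list of `A`: the multiplicities of the distinct
eigenvalues of `A`, listed in increasing order of the eigenvalues. -/
noncomputable def omlist {n : ℕ} (A : Matrix (Fin n) (Fin n) ℝ) : List ℕ :=
  (A.charpoly.roots.toFinset.sort (· ≤ ·)).map fun x => A.charpoly.roots.count x

/-- A real symmetric matrix is annihilated by the product of `X - μ` over its distinct eigenvalues. -/
theorem aeval_prod_roots_eq_zero {ι : Type*} [Fintype ι] [DecidableEq ι]
    {A : Matrix ι ι ℝ} (hA : A.IsSymm) :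
    aeval A (∏ μ ∈ A.charpoly.roots.toFinset, (X - C μ)) = 0 := by
  have hH : A.IsHermitian := by
    rw [Matrix.IsHermitian, conjTranspose_eq_transpose_of_trivial]; exact hA
  set p := ∏ μ ∈ A.charpoly.roots.toFinset, (X - C μ) with hp
  have hroot : ∀ i, p.eval (hH.eigenvalues i) = 0 := fun i => by
    rw [hp, eval_prod]
    refine Finset.prod_eq_zero (i := hH.eigenvalues i) ?_ (by simp)
    rw [hH.roots_charpoly_eq_eigenvalues]
    simp
  have hdiag : aeval (diagonal hH.eigenvalues) p = 0 := by
    have h := aeval_algHom_apply (diagonalAlgHom (n := ι) (α := ℝ) ℝ) hH.eigenvalues p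
    have h0 : aeval hH.eigenvalues p = 0 := by
      funext i
      simp [hroot i]
    rw [h0, map_zero] at h
    exact h
  have hspec := hH.spectral_theorem
  have h := aeval_algHom_apply
    (Unitary.conjStarAlgAut ℝ _ hH.eigenvectorUnitary).toAlgEquiv.toAlgHom
    (diagonal hH.eigenvalues) p
  rw [hdiag, map_zero] at h
  rw [hspec]
  exact h

/-- Trace orthogonality to the powers of `A` below the number of distinct eigenvalues
extends to all powers of `A`. -/
theorem trace_pow_mul_eq_zero {n : ℕ} {A : Matrix (Fin n) (Fin n) ℝ} (hA : A.IsSymm)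
    {Y : Matrix (Fin n) (Fin n) ℝ} (h : ∀ k < qDist A, trace (A ^ k * Y) = 0) (k : ℕ) :
    trace (A ^ k * Y) = 0 := by
  set p := ∏ μ ∈ A.charpoly.roots.toFinset, (X - C μ) with hp
  have hmonic : p.Monic := monic_prod_of_monic _ _ fun μ _ => monic_X_sub_C μ
  have hdeg : p.natDegree = qDist A := by
    rw [hp, natDegree_prod_of_monic _ _ fun μ _ => monic_X_sub_C μ]
    simp [qDist]
  have hk : A ^ k = aeval A (X ^ k %ₘ p) := by
    conv_lhs => rw [← aeval_X (R := ℝ) A, ← map_pow, ← modByMonic_add_div (X ^ k) p]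
    simp [hp, aeval_prod_roots_eq_zero hA]
  rw [hk, aeval_eq_sum_range, Finset.sum_mul, trace_sum]
  refine Finset.sum_eq_zero fun i hi => ?_
  rw [smul_mul_assoc, trace_smul]
  by_cases hiq : i < qDist A
  · rw [h i hiq, smul_zero]
  · rw [coeff_eq_zero_of_degree_lt, zero_smul]
    refine (degree_modByMonic_lt _ hmonic).trans_le ?_
    rw [degree_eq_natDegree hmonic.ne_zero, hdeg]
    exact_mod_cast not_lt.mp hiq

/-- A matrix of a cycle has three entries per row, so multiplication is a three-term recurrence. -/
theorem sMem.mul_apply {m : ℕ} {A : Matrix (Fin (m + 3)) (Fin (m + 3)) ℝ}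
    (hA : sMem (SimpleGraph.cycleGraph (m + 3)) A) (Y : Matrix (Fin (m + 3)) (Fin (m + 3)) ℝ)
    (i j : Fin (m + 3)) :
    (A * Y) i j = A (i - 1) i * Y (i - 1) j + A i i * Y i j + A i (i + 1) * Y (i + 1) j := by
  have h1 : (1 : Fin (m + 3)) ≠ 0 := by simp
  have h2 : (1 : Fin (m + 3)) + 1 ≠ 0 := by
    intro h
    have := congrArg Fin.val h
    simp [Fin.val_add, Nat.mod_eq_of_lt] at this
  have n1 : i - 1 ≠ i := fun h => h1 (by simp at h)
  have n2 : i ≠ i + 1 := fun h => h1 (by simp at h)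
  have n3 : i - 1 ≠ i + 1 := fun h => h2 (by
    rw [sub_eq_iff_eq_add, add_assoc] at h; simpa using h)
  rw [Matrix.mul_apply, ← Finset.sum_subset (Finset.subset_univ {i - 1, i, i + 1})]
  · rw [Finset.sum_insert (by simp [n1, n3]), Finset.sum_pair n2, hA.1.apply (i - 1) i]
    ring
  · intro k _ hk
    simp only [Finset.mem_insert, Finset.mem_singleton, not_or] at hk
    have : A i k = 0 := by
      by_contra h
      rcases (hA.2 i k (Ne.symm hk.2.1)).1 h with h | h
      · exact hk.1 (by rw [← h]; abel)
      · exact hk.2.2 (by rw [← h]; abel)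
    rw [this, zero_mul]

theorem sMem.superdiag_ne_zero {m : ℕ} {A : Matrix (Fin (m + 3)) (Fin (m + 3)) ℝ}
    (hA : sMem (SimpleGraph.cycleGraph (m + 3)) A) (i : Fin (m + 3)) : A i (i + 1) ≠ 0 := by
  refine (hA.2 i (i + 1) (by simp)).2 (SimpleGraph.cycleGraph_adj.2 (Or.inr ?_))
  abel

theorem symm_mul_of_comm {n : ℕ} {A Y : Matrix (Fin n) (Fin n) ℝ} (hA : A.IsSymm) (hY : Y.IsSymm)
    (hc : A * Y = Y * A) : (A * Y).IsSymm := by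
  rw [Matrix.IsSymm, transpose_mul, hA.eq, hY.eq, hc]

/-- A function on `Fin (m + 1)` invariant under the cyclic shift is constant. -/
theorem eq_apply_zero_of_shift {m : ℕ} {α : Type*} {f : Fin (m + 1) → α}
    (hf : ∀ i, f (i + 1) = f i) (i : Fin (m + 1)) : f i = f 0 := by
  induction i using Fin.induction with
  | zero => rfl
  | succ i ih => rw [← ih, ← hf i.castSucc, Fin.coeSucc_eq_succ]

/-- If `Y` commutes with a matrix `A` of a cycle, is trace-orthogonal to the powers of `A`, and
vanishes at cyclic distances below `k + 2`, then it vanishes at cyclic distance `k + 2`. -/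
theorem sMem.apply_eq_zero_of_comm {m : ℕ} {A : Matrix (Fin (m + 3)) (Fin (m + 3)) ℝ}
    (hA : sMem (SimpleGraph.cycleGraph (m + 3)) A) (k : ℕ) :
    ∀ {Y : Matrix (Fin (m + 3)) (Fin (m + 3)) ℝ}, Y.IsSymm → A * Y = Y * A →
      (∀ l, trace (A ^ l * Y) = 0) → (∀ e < k + 2, ∀ i, Y i (i + e • 1) = 0) →
      ∀ i, Y i (i + (k + 2) • 1) = 0 := by
  induction k with
  | zero =>
    intro Y hY hc ht h0 i
    have hd : ∀ i, Y i i = 0 := fun i => by simpa using h0 0 (by omega) i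
    have hs : ∀ i, Y i (i + 1) = 0 := fun i => by simpa using h0 1 (by omega) i
    have hsymm := symm_mul_of_comm hA.1 hY hc
    have hleft : ∀ i, (A * Y) i (i + 1) = A (i - 1) i * Y (i - 1) (i + 1) := fun i => by
      rw [hA.mul_apply, hs, hd]; ring
    have hright : ∀ i, (A * Y) i (i + 1) = A (i + 1) (i + 1 + 1) * Y i (i + 1 + 1) := fun i => by
      rw [← hsymm.apply, hA.mul_apply, add_sub_cancel_right, hd, hY.apply, hs, hY.apply]; ring
    set f : Fin (m + 3) → ℝ := fun i => A i (i + 1) * (A * Y) i (i + 1) with hf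
    have hshift : ∀ i, f (i + 1) = f i := fun i => by
      simp only [hf]
      rw [hleft (i + 1), hright i, add_sub_cancel_right]; ring
    have hconst := eq_apply_zero_of_shift hshift
    have hdiag : ∀ i, (A ^ 2 * Y) i i = 2 * f 0 := fun i => by
      rw [pow_two, mul_assoc, hA.mul_apply, ← hsymm.apply (i + 1) i]
      have hii : (A * Y) i i = 0 := by
        rw [hA.mul_apply, hd, ← hY.apply (i + 1) i, hs]
        have := hs (i - 1)
        rw [sub_add_cancel] at this
        rw [this]; ring
      have e1 := hconst (i - 1)
      have e2 := hconst i
      simp only [hf, sub_add_cancel] at e1 e2 ⊢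
      rw [hii]
      linarith
    have hzero : f 0 = 0 := by
      have := ht 2
      simp only [trace, diag_apply, hdiag, Finset.sum_const, Finset.card_univ, Fintype.card_fin,
        nsmul_eq_mul] at this
      have hm : ((m + 3 : ℕ) : ℝ) ≠ 0 := by positivity
      simpa [hm] using (mul_eq_zero.1 this).resolve_left hm
    have hi : f i = 0 := (hconst i).trans hzero
    have : (A * Y) i (i + 1) = 0 := (mul_eq_zero.1 hi).resolve_left (hA.superdiag_ne_zero i)
    rw [hright] at this
    have := (mul_eq_zero.1 this).resolve_left (hA.superdiag_ne_zero _)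
    rw [zero_add, two_nsmul, ← add_assoc]
    exact this
  | succ k ih =>
    intro Y hY hc ht h0 i
    have hd : ∀ i, Y i i = 0 := fun i => by simpa using h0 0 (by omega) i
    have hs : ∀ i, Y i (i + 1) = 0 := fun i => by simpa using h0 1 (by omega) i
    have hshift : ∀ e : ℕ, ∀ i : Fin (m + 3), i + e • 1 = i - 1 + (e + 1) • 1 := fun e i => by
      rw [succ_nsmul]; abel
    have hshift' : ∀ e : ℕ, ∀ i : Fin (m + 3), i + (e + 1) • 1 = i + 1 + e • 1 := fun e i => by
      rw [succ_nsmul]; abel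
    have hstep : ∀ e < k + 3, ∀ i,
        (A * Y) i (i + e • 1) = A (i - 1) i * Y (i - 1) (i - 1 + (e + 1) • 1) := by
      intro e he i
      have hnext : Y (i + 1) (i + e • 1) = 0 := by
        rcases e with _ | e
        · rw [zero_nsmul, add_zero, hY.apply, hs]
        · rw [hshift' e i]; exact h0 e (by omega) _
      rw [hA.mul_apply, h0 e (by omega) i, hnext, hshift e i]; ring
    have hAY := ih (Y := A * Y) (symm_mul_of_comm hA.1 hY hc)
      (by rw [mul_assoc, ← hc])
      (fun l => by rw [← mul_assoc, ← pow_succ]; exact ht (l + 1))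
      (fun e he i => by rw [hstep e (by omega), h0 (e + 1) (by omega), mul_zero])
    have := hAY (i + 1)
    rw [hstep (k + 2) (by omega), add_sub_cancel_right] at this
    exact (mul_eq_zero.1 this).resolve_left (hA.superdiag_ne_zero i)

/-- Every matrix of a cycle has the strong multiplicity property. -/
theorem sMem.hasSMP {m : ℕ} {A : Matrix (Fin (m + 3)) (Fin (m + 3)) ℝ}
    (hA : sMem (SimpleGraph.cycleGraph (m + 3)) A) : HasSMP A := by
  intro Y hY hAY hdiag hc ht
  have key : ∀ e : ℕ, ∀ i, Y i (i + e • 1) = 0 := by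
    intro e
    induction e using Nat.strong_induction_on with
    | _ e ih =>
      match e with
      | 0 => simpa using hdiag
      | 1 =>
        intro i
        simpa using (mul_eq_zero.1 (hAY i (i + 1))).resolve_left (hA.superdiag_ne_zero i)
      | k + 2 => exact hA.apply_eq_zero_of_comm k hY hc (trace_pow_mul_eq_zero hA.1 ht) ih
  ext i j
  have h : (j - i).val • (1 : Fin (m + 3)) = j - i := by
    open Fin.CommRing in
    rw [nsmul_one, Fin.cast_val_eq_self]
  have := key (j - i).val i
  rwa [h, add_sub_cancel] at this

/-- Theorem 10: every ordered multiplicity list achievable by a matrix in `S(Cₙ)`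
is achievable by a matrix in `S(Cₙ)` with the SMP. -/
theorem cycle_omlist_smp (n : ℕ) (hn : 3 ≤ n)
    (A : Matrix (Fin n) (Fin n) ℝ) (hA : sMem (SimpleGraph.cycleGraph n) A) :
    ∃ A' : Matrix (Fin n) (Fin n) ℝ,
      sMem (SimpleGraph.cycleGraph n) A' ∧ HasSMP A' ∧ omlist A' = omlist A := by
  obtain ⟨m, rfl⟩ : ∃ m, n = m + 3 := ⟨n - 3, by omega⟩
  exact ⟨A, hA, hA.hasSMP, rfl⟩
end

section
/- Let P be an n×n sign pattern and let A ∈ Q(P) have the non-symmetric strong spectral property (nSSP). Then there is ε > 0 such that for every n×n real matrix M with ‖M − A‖ < ε, there exists a matrix A' ∈ Q(P) such that A' has the nSSP and A' is similar to M (i.e., there is an invertible real matrix S with A' = S⁻¹ M S). -/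
open Matrix Polynomial

/-- `A` belongs to the qualitative class `Q(P)` of the sign pattern `P`. -/
def qMem {n : ℕ} (P : Fin n → Fin n → SignType) (A : Matrix (Fin n) (Fin n) ℝ) : Prop :=
  ∀ i j, SignType.sign (A i j) = P i j

/-- The non-symmetric strong spectral property. -/
def HasNSSP {n : ℕ} (A : Matrix (Fin n) (Fin n) ℝ) : Prop :=
  ∀ X : Matrix (Fin n) (Fin n) ℝ,
    (∀ i j, A i j * X i j = 0) → A * Xᵀ = Xᵀ * A → X = 0

/-- The Frobenius norm of a real matrix. -/
noncomputable def frobNorm {n : ℕ} (A : Matrix (Fin n) (Fin n) ℝ) : ℝ :=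
  Real.sqrt (∑ i, ∑ j, (A i j) ^ 2)

section FrobeniusNorm

open scoped Matrix.Norms.Frobenius Topology

variable {n : ℕ}

theorem frobNorm_eq_norm (A : Matrix (Fin n) (Fin n) ℝ) : frobNorm A = ‖A‖ := by
  simp [frobNorm, Matrix.frobenius_norm_def, Real.sqrt_eq_rpow]

theorem exists_frobNorm_lt_imp_of_eventually_nhds {A : Matrix (Fin n) (Fin n) ℝ}
    {p : Matrix (Fin n) (Fin n) ℝ → Prop} (h : ∀ᶠ M in 𝓝 A, p M) :
    ∃ ε > 0, ∀ M, frobNorm (M - A) < ε → p M := by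
  obtain ⟨ε, hε, hp⟩ := Metric.eventually_nhds_iff.1 h
  exact ⟨ε, hε, fun M hM => hp (by rwa [dist_eq_norm, ← frobNorm_eq_norm])⟩

/-- The linear conditions on `X` in the definition of the nSSP of `A`, as a map bilinear
in `A` and `X`. -/
def nsspBilin (n : ℕ) : Matrix (Fin n) (Fin n) ℝ →ₗ[ℝ] Matrix (Fin n) (Fin n) ℝ →ₗ[ℝ]
    Matrix (Fin n) (Fin n) ℝ × Matrix (Fin n) (Fin n) ℝ :=
  LinearMap.mk₂ ℝ (fun A X => (A ⊙ X, A * Xᵀ - Xᵀ * A))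
    (fun A B X => by
      simp only [add_hadamard, add_mul, mul_add, Prod.mk_add_mk]; congr 1; abel)
    (fun c A X => by simp [smul_sub])
    (fun A X Y => by
      simp only [hadamard_add, transpose_add, add_mul, mul_add, Prod.mk_add_mk]; congr 1; abel)
    (fun c A X => by simp [smul_sub])

theorem hasNSSP_iff_injective_nsspBilin (A : Matrix (Fin n) (Fin n) ℝ) :
    HasNSSP A ↔ Function.Injective (nsspBilin n A) := by
  rw [injective_iff_map_eq_zero]
  simp only [HasNSSP, nsspBilin, LinearMap.mk₂_apply, Prod.mk_eq_zero, sub_eq_zero, and_imp,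
    ← Matrix.ext_iff, hadamard_apply, Matrix.zero_apply]

theorem isOpen_hasNSSP : IsOpen {A : Matrix (Fin n) (Fin n) ℝ | HasNSSP A} := by
  let Φ := LinearMap.toContinuousLinearMap.toLinearMap ∘ₗ nsspBilin n
  have hΦ : Continuous Φ := Φ.continuous_of_finiteDimensional
  convert! ContinuousLinearMap.isOpen_injective.preimage hΦ using 1
  ext A
  exact hasNSSP_iff_injective_nsspBilin A

/-- The derivative at the origin of `(B, T) ↦ (1 + T) * (A + A ⊙ B) * (1 + T)⁻¹`. -/
noncomputable def scaleConjDeriv (A : Matrix (Fin n) (Fin n) ℝ) :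
    Matrix (Fin n) (Fin n) ℝ × Matrix (Fin n) (Fin n) ℝ →L[ℝ] Matrix (Fin n) (Fin n) ℝ :=
  LinearMap.toContinuousLinearMap
    { toFun := fun p => A ⊙ p.1 + (p.2 * A - A * p.2)
      map_add' := fun p q => by
        simp only [Prod.fst_add, Prod.snd_add, hadamard_add, add_mul, mul_add]; abel
      map_smul' := fun c p => by simp [smul_sub] }

theorem range_scaleConjDeriv_eq_top {A : Matrix (Fin n) (Fin n) ℝ} (hA : HasNSSP A) :
    (scaleConjDeriv A).range = ⊤ := by
  by_contra hne
  obtain ⟨f, hf, hle⟩ := Submodule.exists_le_ker_of_lt_top _ (lt_top_iff_ne_top.2 hne)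
  have hf0 (B T : Matrix (Fin n) (Fin n) ℝ) : f (A ⊙ B + (T * A - A * T)) = 0 :=
    hle ⟨(B, T), rfl⟩
  let Y : Matrix (Fin n) (Fin n) ℝ := of fun i j => f (single i j 1)
  have hfY (Z : Matrix (Fin n) (Fin n) ℝ) : f Z = ∑ i, ∑ j, Z i j * Y i j := by
    conv_lhs => rw [matrix_eq_sum_single Z]
    simp only [map_sum]
    refine Finset.sum_congr rfl fun i _ => Finset.sum_congr rfl fun j _ => ?_
    rw [← mul_one (Z i j), ← smul_eq_mul, ← smul_single, map_smul]
    simp [Y]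
  have hY : Y = 0 := by
    refine hA Y (fun i j => ?_) (Matrix.ext fun j i => ?_)
    · have h := hf0 (single i j 1) 0
      simpa [hfY, hadamard_apply, single_apply, ite_and] using h
    · have h := hf0 0 (single i j 1)
      rw [hadamard_zero, zero_add, map_sub, sub_eq_zero, hfY, hfY] at h
      simpa [Matrix.mul_apply, single_apply, ite_and, mul_comm] using h
  refine hf (LinearMap.ext fun Z => ?_)
  simp [hfY, hY]

theorem hasStrictFDerivAt_scaleConj (A : Matrix (Fin n) (Fin n) ℝ) :
    HasStrictFDerivAt
      (fun p : Matrix (Fin n) (Fin n) ℝ × Matrix (Fin n) (Fin n) ℝ =>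
        (1 + p.2) * (A + A ⊙ p.1) * Ring.inverse (1 + p.2))
      (scaleConjDeriv A) 0 := by
  let H : Matrix (Fin n) (Fin n) ℝ →L[ℝ] Matrix (Fin n) (Fin n) ℝ :=
    LinearMap.toContinuousLinearMap
      { toFun := fun B => A ⊙ B
        map_add' := fun B C => hadamard_add A B C
        map_smul' := fun c B => hadamard_smul A B c }
  have hT : HasStrictFDerivAt (fun p : Matrix (Fin n) (Fin n) ℝ × Matrix (Fin n) (Fin n) ℝ =>
      1 + p.2) (ContinuousLinearMap.snd ℝ _ _) 0 := hasStrictFDerivAt_snd.const_add 1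
  have hB : HasStrictFDerivAt (fun p : Matrix (Fin n) (Fin n) ℝ × Matrix (Fin n) (Fin n) ℝ =>
      A + A ⊙ p.1) (H ∘L ContinuousLinearMap.fst ℝ _ _) 0 :=
    (H.hasStrictFDerivAt.comp 0 hasStrictFDerivAt_fst).const_add A
  have hI : HasStrictFDerivAt (fun p : Matrix (Fin n) (Fin n) ℝ × Matrix (Fin n) (Fin n) ℝ =>
      Ring.inverse (1 + p.2))
      ((-ContinuousLinearMap.mulLeftRight ℝ (Matrix (Fin n) (Fin n) ℝ) 1 1) ∘L
        ContinuousLinearMap.snd ℝ _ _) 0 := by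
    refine HasStrictFDerivAt.comp (g := Ring.inverse) 0 ?_ hT
    simpa using hasStrictFDerivAt_ringInverse (𝕜 := ℝ) (1 : (Matrix (Fin n) (Fin n) ℝ)ˣ)
  convert! (hT.mul' hB).mul' hI using 1
  refine ContinuousLinearMap.ext fun p => ?_
  change A ⊙ p.1 + (p.2 * A - A * p.2) = (1 + 0) * (A + A ⊙ 0) * (-(1 * p.2 * 1)) +
    ((1 + 0) * (A ⊙ p.1) + p.2 * (A + A ⊙ 0)) * Ring.inverse (1 + 0)
  simp only [hadamard_zero, add_zero, one_mul, mul_one, Ring.inverse_one, mul_neg]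
  abel

theorem qMem_add_hadamard {P : Fin n → Fin n → SignType} {A B : Matrix (Fin n) (Fin n) ℝ}
    (hA : qMem P A) (hB : ∀ i j, 0 < 1 + B i j) : qMem P (A + A ⊙ B) := by
  intro i j
  rw [← hA i j, Matrix.add_apply, hadamard_apply, ← mul_one_add, sign_mul, sign_pos (hB i j),
    mul_one]

theorem eventually_similar {A : Matrix (Fin n) (Fin n) ℝ} {P : Fin n → Fin n → SignType}
    (hA : qMem P A) (hnssp : HasNSSP A) :
    ∀ᶠ M in 𝓝 A, ∃ A' : Matrix (Fin n) (Fin n) ℝ, qMem P A' ∧ HasNSSP A' ∧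
      ∃ S : Matrix (Fin n) (Fin n) ℝ, IsUnit S.det ∧ A' = S⁻¹ * M * S := by
  have hmap := (hasStrictFDerivAt_scaleConj A).map_nhds_eq_of_surj
    (range_scaleConjDeriv_eq_top hnssp)
  simp only [Prod.fst_zero, Prod.snd_zero, hadamard_zero, add_zero, Ring.inverse_one, one_mul,
    mul_one] at hmap
  refine Filter.Eventually.filter_mono hmap.ge (Filter.eventually_map.2 ?_)
  have hpos : ∀ᶠ p : Matrix (Fin n) (Fin n) ℝ × Matrix (Fin n) (Fin n) ℝ in 𝓝 0,
      ∀ i j, 0 < 1 + p.1 i j := by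
    refine Filter.eventually_all.2 fun i => Filter.eventually_all.2 fun j => ?_
    have hc : Continuous fun p : Matrix (Fin n) (Fin n) ℝ × Matrix (Fin n) (Fin n) ℝ =>
        1 + p.1 i j := continuous_const.add (continuous_fst.matrix_elem i j)
    exact hc.continuousAt.eventually (lt_mem_nhds (by simp))
  have hopen : ∀ᶠ p : Matrix (Fin n) (Fin n) ℝ × Matrix (Fin n) (Fin n) ℝ in 𝓝 0,
      HasNSSP (A + A ⊙ p.1) := by
    have hc : ContinuousAt (fun p : Matrix (Fin n) (Fin n) ℝ × Matrix (Fin n) (Fin n) ℝ =>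
        A + A ⊙ p.1) 0 := by
      refine Continuous.continuousAt (continuous_matrix fun i j => ?_)
      simp only [Matrix.add_apply, hadamard_apply]
      exact continuous_const.add (continuous_const.mul (continuous_fst.matrix_elem i j))
    exact hc.eventually (isOpen_hasNSSP.mem_nhds (by simpa using hnssp))
  have hunit : ∀ᶠ p : Matrix (Fin n) (Fin n) ℝ × Matrix (Fin n) (Fin n) ℝ in 𝓝 0,
      IsUnit (1 + p.2) := by
    have hc : ContinuousAt (fun p : Matrix (Fin n) (Fin n) ℝ × Matrix (Fin n) (Fin n) ℝ =>
        1 + p.2) 0 := (continuous_const.add continuous_snd).continuousAt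
    exact hc.eventually (Units.isOpen.mem_nhds (by simp))
  filter_upwards [hpos, hopen, hunit] with p h₁ h₂ h₃
  have hdet := (Matrix.isUnit_iff_isUnit_det _).1 h₃
  refine ⟨A + A ⊙ p.1, qMem_add_hadamard hA h₁, h₂, 1 + p.2, hdet, ?_⟩
  rw [← Matrix.nonsing_inv_eq_ringInverse, ← mul_assoc, ← mul_assoc,
    Matrix.nonsing_inv_mul _ hdet, one_mul, mul_assoc, Matrix.nonsing_inv_mul _ hdet, mul_one]

end FrobeniusNorm

/-- Theorem 12 (bifurcation lemma for non-symmetric matrices): if `A ∈ Q(P)` has the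
nSSP, then every matrix near `A` is similar to a matrix in `Q(P)` with the nSSP. -/
theorem bifurcation_nssp (n : ℕ) (P : Fin n → Fin n → SignType)
    (A : Matrix (Fin n) (Fin n) ℝ) (hA : qMem P A) (hnssp : HasNSSP A) :
    ∃ ε > 0, ∀ M : Matrix (Fin n) (Fin n) ℝ, frobNorm (M - A) < ε →
      ∃ A' : Matrix (Fin n) (Fin n) ℝ, qMem P A' ∧ HasNSSP A' ∧
        ∃ S : Matrix (Fin n) (Fin n) ℝ, IsUnit S.det ∧ A' = S⁻¹ * M * S := by
  exact exists_frobNorm_lt_imp_of_eventually_nhds (eventually_similar hA hnssp)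
end

section
/- Let P be an n×n sign pattern and let A ∈ Q(P) have the non-symmetric strong spectral property (nSSP). Then for every superpattern P' of P, there exists a matrix A' ∈ Q(P') such that A' has the nSSP and A' is similar to A (i.e., there is an invertible real matrix S with A' = S⁻¹ A S). -/
open Matrix Polynomial

open Filter Topology

attribute [local instance] Matrix.linftyOpNormedRing Matrix.linftyOpNormedAlgebra

theorem LinearMap.eventually_injective {V W T : Type*} [AddCommGroup V] [Module ℝ V]
    [FiniteDimensional ℝ V] [NormedAddCommGroup W] [NormedSpace ℝ W] [TopologicalSpace T]
    (L : T → V →ₗ[ℝ] W) (hL : ∀ v, Continuous fun t => L t v) {t₀ : T}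
    (h : Function.Injective (L t₀)) : ∀ᶠ t in 𝓝 t₀, Function.Injective (L t) := by
  let b := Module.finBasis ℝ V
  have key (t : T) : LinearIndependent ℝ (fun i => L t (b i)) ↔ Function.Injective (L t) := by
    refine ⟨fun hi => ?_, fun hi => b.linearIndependent.map' _ (LinearMap.ker_eq_bot.2 hi)⟩
    rw [injective_iff_map_eq_zero]
    intro v hv
    rw [← b.sum_repr v, map_sum] at hv
    simp only [map_smul] at hv
    refine b.ext_elem fun i => ?_
    simpa using Fintype.linearIndependent_iff.1 hi _ hv i
  have hc : Continuous fun t => fun i => L t (b i) := continuous_pi fun i => hL (b i)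
  filter_upwards [(isOpen_setOfPred_linearIndependent.preimage hc).mem_nhds ((key t₀).2 h)]
    with t ht using (key t).1 ht

variable {n : ℕ}

/-- If `A` has the nSSP, so does every matrix near `A` whose support contains that of `A`. -/
theorem HasNSSP.eventually {A : Matrix (Fin n) (Fin n) ℝ} (hA : HasNSSP A) :
    ∀ᶠ B in 𝓝 A, (∀ i j, A i j ≠ 0 → B i j ≠ 0) → HasNSSP B := by
  let L (B : Matrix (Fin n) (Fin n) ℝ) : Matrix (Fin n) (Fin n) ℝ →ₗ[ℝ]
      Matrix (Fin n) (Fin n) ℝ × Matrix (Fin n) (Fin n) ℝ :=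
    { toFun X := (Matrix.of fun i j => A i j * X i j, B * Xᵀ - Xᵀ * B)
      map_add' X Y := by
        ext <;> simp [mul_add, add_mul]
        ring
      map_smul' c X := by
        ext <;> simp
        · ring
        · ring }
  have hL : Function.Injective (L A) := by
    rw [injective_iff_map_eq_zero]
    intro X hX
    obtain ⟨h₁, h₂⟩ := Prod.ext_iff.1 hX
    exact hA X (fun i j => congrFun₂ h₁ i j) (sub_eq_zero.1 h₂)
  filter_upwards [LinearMap.eventually_injective L
    (fun X => by simp only [L, LinearMap.coe_mk, AddHom.coe_mk]; fun_prop) hL]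
    with B hB hsupp X h₁ h₂
  refine (injective_iff_map_eq_zero _).1 hB X (Prod.ext ?_ (sub_eq_zero.2 h₂))
  ext i j
  by_cases h : A i j = 0
  · simp [L, h]
  · simp [L, (mul_eq_zero.1 (h₁ i j)).resolve_left (hsupp i j h)]

/-- The restriction of a matrix to the zero positions of `A`. -/
noncomputable def restrictZeros (A : Matrix (Fin n) (Fin n) ℝ) :
    Matrix (Fin n) (Fin n) ℝ →L[ℝ] ({p : Fin n × Fin n // A p.1 p.2 = 0} → ℝ) :=
  LinearMap.toContinuousLinearMap
    { toFun M p := M p.1.1 p.1.2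
      map_add' _ _ := rfl
      map_smul' _ _ := rfl }

@[simp]
theorem restrictZeros_apply (A M : Matrix (Fin n) (Fin n) ℝ)
    (p : {p : Fin n × Fin n // A p.1 p.2 = 0}) : restrictZeros A M p = M p.1.1 p.1.2 := rfl

/-- The derivative at `S = 1` of `S ↦ S⁻¹ * A * S`. -/
noncomputable def commutatorCLM (A : Matrix (Fin n) (Fin n) ℝ) :
    Matrix (Fin n) (Fin n) ℝ →L[ℝ] Matrix (Fin n) (Fin n) ℝ :=
  ContinuousLinearMap.mul ℝ _ A - (ContinuousLinearMap.mul ℝ _).flip A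

@[simp]
theorem commutatorCLM_apply (A K : Matrix (Fin n) (Fin n) ℝ) :
    commutatorCLM A K = A * K - K * A := rfl

theorem hasStrictFDerivAt_conj (A : Matrix (Fin n) (Fin n) ℝ) :
    HasStrictFDerivAt (fun S : Matrix (Fin n) (Fin n) ℝ => S⁻¹ * A * S) (commutatorCLM A) 1 := by
  simp only [Matrix.nonsing_inv_eq_ringInverse]
  have h := ((hasStrictFDerivAt_ringInverse (𝕜 := ℝ)
    (1 : (Matrix (Fin n) (Fin n) ℝ)ˣ)).mul_const' A).mul' (hasStrictFDerivAt_id _)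
  refine h.congr_fderiv ?_
  ext1 K
  refine Eq.trans ?_ (commutatorCLM_apply A K).symm
  simp [sub_eq_add_neg]

theorem HasNSSP.surjective_restrictZeros_commutator {A : Matrix (Fin n) (Fin n) ℝ}
    (hA : HasNSSP A) : Function.Surjective (restrictZeros A ∘L commutatorCLM A) := by
  rw [← ContinuousLinearMap.coe_coe, ← LinearMap.dualMap_injective_iff, injective_iff_map_eq_zero]
  intro φ hφ
  let X : Matrix (Fin n) (Fin n) ℝ := Matrix.of fun i j =>
    if h : A i j = 0 then φ (Pi.single ⟨(i, j), h⟩ 1) else 0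
  have hφX (M : Matrix (Fin n) (Fin n) ℝ) : φ (restrictZeros A M) = (Xᵀ * M).trace := by
    rw [LinearMap.pi_apply_eq_sum_univ φ, Matrix.trace_mul_comm, Matrix.trace]
    simp only [Matrix.diag_apply, Matrix.mul_apply, Matrix.transpose_apply]
    rw [← Fintype.sum_prod_type' fun i j => M i j * X i j]
    refine Fintype.sum_of_injective Subtype.val Subtype.val_injective _ _ (fun p hp => ?_) ?_
    · have : A p.1 p.2 ≠ 0 := fun h => hp ⟨⟨p, h⟩, rfl⟩
      simp [X, this]
    · intro p
      have h : (fun q => if p = q then (1 : ℝ) else 0) = Pi.single p 1 := by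
        ext q
        simp [Pi.single_apply, eq_comm]
      simp [X, p.2, h]
  have hX : X = 0 := by
    refine hA X (fun i j => ?_) ?_
    · by_cases h : A i j = 0 <;> simp [X, h]
    · rw [Matrix.ext_iff_trace_mul_right]
      intro K
      have h : φ (restrictZeros A (A * K - K * A)) = 0 := LinearMap.congr_fun hφ K
      rw [hφX, mul_sub, Matrix.trace_sub, sub_eq_zero, ← mul_assoc, ← mul_assoc,
        Matrix.trace_mul_comm _ A, ← mul_assoc] at h
      exact h.symm
  refine LinearMap.pi_ext' fun p => LinearMap.ext_ring ?_
  have := congrFun₂ hX p.1.1 p.1.2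
  simpa [X, p.2] using this

/-- Theorem 13 (superpattern lemma): if `A ∈ Q(P)` has the nSSP, then for every
superpattern `P'` of `P` there is a matrix in `Q(P')` with the nSSP similar to `A`. -/
theorem superpattern_lemma (n : ℕ) (P P' : Fin n → Fin n → SignType)
    (hsuper : ∀ i j, P i j ≠ 0 → P' i j = P i j)
    (A : Matrix (Fin n) (Fin n) ℝ) (hA : qMem P A) (hnssp : HasNSSP A) :
    ∃ A' : Matrix (Fin n) (Fin n) ℝ, qMem P' A' ∧ HasNSSP A' ∧
      ∃ S : Matrix (Fin n) (Fin n) ℝ, IsUnit S.det ∧ A' = S⁻¹ * A * S := by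
  let f : Matrix (Fin n) (Fin n) ℝ → Matrix (Fin n) (Fin n) ℝ := fun S => S⁻¹ * A * S
  have hf : HasStrictFDerivAt f (commutatorCLM A) 1 := hasStrictFDerivAt_conj A
  have hf1 : f 1 = A := by simp [f]
  have hft : Tendsto f (𝓝 1) (𝓝 A) := by simpa [hf1] using hf.continuousAt.tendsto
  have hdet : ∀ᶠ S : Matrix (Fin n) (Fin n) ℝ in 𝓝 1, S.det ≠ 0 :=
    (continuous_id.matrix_det.continuousAt (x := (1 : Matrix (Fin n) (Fin n) ℝ))).eventually_ne
      (by simp)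
  have hsign : ∀ᶠ B in 𝓝 A, ∀ i j, A i j ≠ 0 → SignType.sign (B i j) = SignType.sign (A i j) := by
    simp only [eventually_all]
    intro i j h
    have hc : Tendsto (fun B : Matrix (Fin n) (Fin n) ℝ => B i j) (𝓝 A) (𝓝 (A i j)) :=
      (continuous_id.matrix_elem i j).tendsto A
    exact hc.eventually ((continuousAt_sign_of_ne_zero h).eventually_mem
      ((isOpen_discrete {SignType.sign (A i j)}).mem_nhds rfl))
  have hmap : map (restrictZeros A ∘ f) (𝓝 1) = 𝓝 0 := by
    have h := ((restrictZeros A).hasStrictFDerivAt.comp 1 hf).map_nhds_eq_of_surj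
      (LinearMap.range_eq_top.2 hnssp.surjective_restrictZeros_commutator)
    refine h.trans (congrArg 𝓝 ?_)
    ext p
    simp [hf1, p.2]
  have hgood := image_mem_map (m := restrictZeros A ∘ f)
    (hdet.and (hft.eventually (hsign.and hnssp.eventually)))
  rw [hmap] at hgood
  let c : {p : Fin n × Fin n // A p.1 p.2 = 0} → ℝ := fun p => (P' p.1.1 p.1.2 : ℝ)
  have hc : Tendsto (fun t : ℝ => t • c) (𝓝[>] 0) (𝓝 0) :=
    ((continuous_id.smul continuous_const).tendsto' 0 0 (by simp)).mono_left nhdsWithin_le_nhds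
  obtain ⟨t, ⟨S, ⟨hS, hSsign, hSnssp⟩, hSt⟩, ht⟩ :=
    ((hc.eventually hgood).and self_mem_nhdsWithin).exists
  refine ⟨f S, fun i j => ?_, hSnssp fun i j h => ?_, S, hS.isUnit, rfl⟩
  · by_cases h : A i j = 0
    · have hij : f S i j = t * (P' i j : ℝ) := congrFun hSt ⟨(i, j), h⟩
      rw [hij, sign_mul, sign_pos ht, one_mul]
      cases P' i j <;> simp
    · rw [hSsign i j h, hA i j, hsuper]
      rwa [← hA i j, sign_ne_zero]
  · rw [← sign_ne_zero, hSsign i j h, sign_ne_zero]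
    exact h
end

section
/- Let P be an n×n sign pattern and let A ∈ Q(P). If A is nilpotent and has the non-symmetric strong spectral property (nSSP), then every superpattern of P is a spectrally arbitrary pattern. -/
open Matrix Polynomial

/-- `P` is a spectrally arbitrary pattern: every monic real polynomial of degree `n`
is the characteristic polynomial of a matrix in `Q(P)`. -/
def SpectrallyArbitrary {n : ℕ} (P : Fin n → Fin n → SignType) : Prop :=
  ∀ p : Polynomial ℝ, p.Monic → p.natDegree = n →
    ∃ A : Matrix (Fin n) (Fin n) ℝ, qMem P A ∧ A.charpoly = p

open Filter Topology

namespace NilpotentNSSP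

/-- The nilpotent Jordan block of size `n`, with ones on the superdiagonal. -/
def shift (n : ℕ) : Matrix (Fin n) (Fin n) ℝ :=
  of fun i j => if (j : ℕ) = i + 1 then 1 else 0

/-- The companion matrix of `p`, with ones on the superdiagonal and the coefficients of `p`
in the last row. -/
def companion (n : ℕ) (p : ℝ[X]) : Matrix (Fin n) (Fin n) ℝ :=
  of fun i j => if (i : ℕ) + 1 = n then -p.coeff j else if (j : ℕ) = i + 1 then 1 else 0

theorem charpoly_companion {n : ℕ} {p : ℝ[X]} (hp : p.Monic) (hn : p.natDegree = n) :
    (companion n p).charpoly = p := by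
  subst hn
  have hmin : minpoly ℝ (AdjoinRoot.powerBasis' hp).gen = p := by
    change minpoly ℝ (AdjoinRoot.root p) = p
    rw [AdjoinRoot.minpoly_root hp.ne_zero, hp.leadingCoeff]
    simp
  have h := charpoly_leftMulMatrix (AdjoinRoot.powerBasis' hp)
  rw [PowerBasis.leftMulMatrix, PowerBasis.minpolyGen_eq, hmin, ← charpoly_transpose] at h
  exact h

/-- If `T` has the charpoly with roots scaled by `t`, then `t⁻¹ • T` has the original one. -/
theorem charpoly_inv_smul {n : ℕ} {p : ℝ[X]} (hn : p.natDegree = n)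
    {t : ℝ} (ht : t ≠ 0) {T : Matrix (Fin n) (Fin n) ℝ} (hT : T.charpoly = p.scaleRoots t) :
    (t⁻¹ • T).charpoly = p := by
  refine Polynomial.funext fun x => ?_
  have h1 : (p.scaleRoots t).eval (t * x) = t ^ n * p.eval x := by
    have := scaleRoots_eval₂_mul (p := p) (RingHom.id ℝ) x t
    simpa [hn, eval₂_id] using this
  have h2 : scalar (Fin n) (t * x) - T = t • (scalar (Fin n) x - t⁻¹ • T) := by
    rw [smul_sub, smul_smul, mul_inv_cancel₀ ht, one_smul]
    congr 1
    ext i j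
    simp [diagonal_apply]
  rw [← hT, Matrix.eval_charpoly, h2, det_smul, Fintype.card_fin, ← Matrix.eval_charpoly] at h1
  exact mul_left_cancel₀ (pow_ne_zero n ht) h1

/-- The similarity class of the nilpotent Jordan block. -/
def shiftOrbit (n : ℕ) : Set (Matrix (Fin n) (Fin n) ℝ) :=
  {M | ∃ g h : Matrix (Fin n) (Fin n) ℝ, g * h = 1 ∧ M = g * shift n * h}

/-- Matrices having a positive multiple with characteristic polynomial `p`. -/
def charpolyCone (n : ℕ) (p : ℝ[X]) : Set (Matrix (Fin n) (Fin n) ℝ) :=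
  {T | ∃ t : ℝ, 0 < t ∧ (t • T).charpoly = p}

theorem charpoly_conj {n : ℕ} {g h : Matrix (Fin n) (Fin n) ℝ} (hgh : g * h = 1)
    (M : Matrix (Fin n) (Fin n) ℝ) : (g * M * h).charpoly = M.charpoly := by
  rw [charpoly_mul_comm, ← mul_assoc, mul_eq_one_comm.mp hgh, one_mul]

theorem shiftOrbit_subset_closure_charpolyCone {n : ℕ} {p : ℝ[X]} (hp : p.Monic)
    (hn : p.natDegree = n) : shiftOrbit n ⊆ closure (charpolyCone n p) := by
  rintro _ ⟨g, h, hgh, rfl⟩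
  have hc : Continuous fun t : ℝ => g * companion n (p.scaleRoots t) * h := by
    refine (continuous_const.matrix_mul ?_).matrix_mul continuous_const
    refine continuous_matrix fun i j => ?_
    simp only [companion, of_apply, coeff_scaleRoots]
    split_ifs <;> fun_prop
  have h0 : companion n (p.scaleRoots 0) = shift n := by
    ext i j
    simp only [companion, shift, of_apply, coeff_scaleRoots, hn]
    have hi := i.2
    have hj := j.2
    rw [zero_pow (by omega), mul_zero, neg_zero]
    split_ifs <;> first | rfl | omega
  have ht : Tendsto (fun t : ℝ => g * companion n (p.scaleRoots t) * h) (𝓝[>] 0)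
      (𝓝 (g * shift n * h)) := by
    have := (hc.tendsto 0).mono_left (nhdsWithin_le_nhds (s := Set.Ioi 0))
    rwa [h0] at this
  refine mem_closure_of_tendsto ht ?_
  filter_upwards [self_mem_nhdsWithin] with t (ht : 0 < t)
  refine ⟨t⁻¹, inv_pos.mpr ht, charpoly_inv_smul hn ht.ne' ?_⟩
  rw [charpoly_conj hgh]
  exact charpoly_companion ((monic_scaleRoots_iff t).mpr hp) (by rw [natDegree_scaleRoots, hn])

/-- The block matrix with corner `a`, first row `r`, zero first column and lower block `B`. -/
def block {n : ℕ} (a : ℝ) (r : Fin n → ℝ) (B : Matrix (Fin n) (Fin n) ℝ) :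
    Matrix (Fin (n + 1)) (Fin (n + 1)) ℝ :=
  of (Fin.cons (Fin.cons a r) fun i => Fin.cons 0 (B i))

section block

variable {n : ℕ} (a b : ℝ) (r s : Fin n → ℝ) (B C : Matrix (Fin n) (Fin n) ℝ)

@[simp] theorem block_zero_zero : block a r B 0 0 = a := rfl

@[simp] theorem block_zero_succ (j : Fin n) : block a r B 0 j.succ = r j := rfl

@[simp] theorem block_succ_zero (i : Fin n) : block a r B i.succ 0 = 0 := rfl

@[simp] theorem block_succ_succ (i j : Fin n) : block a r B i.succ j.succ = B i j := rfl

theorem block_mul : block a r B * block b s C = block (a * b) (a • s + r ᵥ* C) (B * C) := by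
  ext i j
  refine Fin.cases ?_ (fun i => ?_) i <;> refine Fin.cases ?_ (fun j => ?_) j <;>
    simp [mul_apply, Fin.sum_univ_succ, vecMul, dotProduct]

theorem block_one : block 1 (0 : Fin n → ℝ) 1 = 1 := by
  ext i j
  refine Fin.cases ?_ (fun i => ?_) i <;> refine Fin.cases ?_ (fun j => ?_) j <;>
    simp [one_apply, Fin.succ_ne_zero, (Fin.succ_ne_zero _).symm]

theorem exists_block_pow (k : ℕ) : ∃ b s, block a r B ^ k = block b s (B ^ k) := by
  induction k with
  | zero => exact ⟨1, 0, by simp [block_one]⟩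
  | succ k ih =>
    obtain ⟨b, s, h⟩ := ih
    exact ⟨_, _, by rw [pow_succ, h, block_mul, ← pow_succ]⟩

theorem isNilpotent_of_block (h : IsNilpotent (block a r B)) : IsNilpotent B := by
  obtain ⟨k, hk⟩ := h
  obtain ⟨b, s, hb⟩ := exists_block_pow a r B k
  refine ⟨k, ?_⟩
  ext i j
  rw [← block_succ_succ b s (B ^ k) i j, ← hb, hk]
  rfl

theorem shift_succ :
    shift (n + 1) = block 0 (fun j => if (j : ℕ) = 0 then 1 else 0) (shift n) := by
  ext i j
  refine Fin.cases ?_ (fun i => ?_) i <;> refine Fin.cases ?_ (fun j => ?_) j <;> simp [shift]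

end block

theorem conj_mem_closure_shiftOrbit {n : ℕ} {g h M : Matrix (Fin n) (Fin n) ℝ} (hgh : g * h = 1)
    (hM : M ∈ closure (shiftOrbit n)) : g * M * h ∈ closure (shiftOrbit n) := by
  have hc : Continuous fun M : Matrix (Fin n) (Fin n) ℝ => g * M * h := by fun_prop
  refine map_mem_closure (f := fun M => g * M * h) hc hM ?_
  rintro _ ⟨g', h', hgh', rfl⟩
  refine ⟨g * g', h' * h, ?_, by simp only [mul_assoc]⟩
  calc g * g' * (h' * h) = g * (g' * h') * h := by simp only [mul_assoc]
    _ = 1 := by rw [hgh', mul_one, hgh]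

theorem block_shift_mem_shiftOrbit {n : ℕ} {r : Fin (n + 1) → ℝ} (hr : r 0 ≠ 0) :
    block 0 r (shift (n + 1)) ∈ shiftOrbit (n + 2) := by
  let w : Fin (n + 1) → ℝ := Fin.snoc (fun j => r j.succ) 0
  have hw : r = r 0 • (fun j : Fin (n + 1) => if (j : ℕ) = 0 then 1 else 0)
      + w ᵥ* shift (n + 1) := by
    ext j
    refine Fin.cases ?_ (fun j => ?_) j
    · simp [vecMul, dotProduct, shift]
    · have : ∀ i : Fin n, ((j : ℕ) = i) ↔ j = i := fun i => Fin.ext_iff.symm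
      simp [vecMul, dotProduct, shift, w, Fin.sum_univ_castSucc, this]
  have hinv : block (r 0) w 1 * block (r 0)⁻¹ (-(r 0)⁻¹ • w) 1 = 1 := by
    have : r 0 • (-(r 0)⁻¹ • w) + w ᵥ* (1 : Matrix (Fin (n + 1)) (Fin (n + 1)) ℝ) = 0 := by
      simp [smul_smul, hr]
    rw [block_mul, mul_inv_cancel₀ hr, this, mul_one, block_one]
  refine ⟨block (r 0) w 1, block (r 0)⁻¹ (-(r 0)⁻¹ • w) 1, hinv, ?_⟩
  have h1 : block (r 0) w 1 * shift (n + 2) = block 0 r (shift (n + 1)) * block (r 0) w 1 := by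
    rw [shift_succ, block_mul, block_mul, ← hw]
    simp
  rw [h1, mul_assoc, hinv, mul_one]

theorem block_shift_mem_closure {n : ℕ} (r : Fin n → ℝ) :
    block 0 r (shift n) ∈ closure (shiftOrbit (n + 1)) := by
  cases n with
  | zero =>
    refine subset_closure ⟨1, 1, one_mul 1, ?_⟩
    rw [one_mul, mul_one, shift_succ]
    congr 1
    exact Subsingleton.elim _ _
  | succ n =>
    have hd : Dense {r : Fin (n + 1) → ℝ | r 0 ≠ 0} :=
      (dense_compl_singleton (0 : ℝ)).preimage (isOpenMap_eval (0 : Fin (n + 1)))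
    have hc : Continuous fun r : Fin (n + 1) → ℝ => block 0 r (shift (n + 1)) := by
      refine continuous_matrix fun i j => ?_
      refine Fin.cases ?_ (fun i => ?_) i <;> refine Fin.cases ?_ (fun j => ?_) j <;>
        simp only [block_zero_zero, block_zero_succ, block_succ_zero, block_succ_succ] <;> fun_prop
    exact map_mem_closure (f := fun r => block 0 r (shift (n + 1))) hc (hd r)
      fun s hs => block_shift_mem_shiftOrbit hs

theorem block_mem_closure {n : ℕ} (r : Fin n → ℝ) {B : Matrix (Fin n) (Fin n) ℝ}
    (hB : B ∈ closure (shiftOrbit n)) : block 0 r B ∈ closure (shiftOrbit (n + 1)) := by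
  have hc : Continuous fun B : Matrix (Fin n) (Fin n) ℝ => block 0 r B := by
    refine continuous_matrix fun i j => ?_
    refine Fin.cases ?_ (fun i => ?_) i <;> refine Fin.cases ?_ (fun j => ?_) j <;>
      simp only [block_zero_zero, block_zero_succ, block_succ_zero, block_succ_succ] <;> fun_prop
  rw [← closure_closure]
  refine map_mem_closure hc hB ?_
  rintro _ ⟨g, h, hgh, rfl⟩
  have h1 : block 1 0 g * block 1 0 h = 1 := by
    rw [block_mul, hgh, ← block_one]
    simp
  have h2 : block 0 r (g * shift n * h) =
      block 1 0 g * block 0 (r ᵥ* g) (shift n) * block 1 0 h := by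
    rw [block_mul, block_mul]
    simp [vecMul_vecMul, hgh]
  rw [h2]
  exact conj_mem_closure_shiftOrbit h1 (block_shift_mem_closure _)

theorem exists_isUnit_det_col_zero {n : ℕ} {v : Fin (n + 1) → ℝ} (hv : v ≠ 0) :
    ∃ g : Matrix (Fin (n + 1)) (Fin (n + 1)) ℝ, IsUnit g.det ∧ ∀ i, g i 0 = v i := by
  obtain ⟨k, hk⟩ := Function.ne_iff.mp hv
  refine ⟨((1 : Matrix _ _ ℝ).updateCol k v).submatrix id (Equiv.swap 0 k), ?_, ?_⟩
  · rw [det_permute', ← cramer_apply, cramer_one]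
    refine IsUnit.mul ?_ (by simpa using hk)
    exact (Units.isUnit _).map (Int.castRingHom ℝ)
  · intro i
    simp

theorem isNilpotent_mem_closure_shiftOrbit {n : ℕ} {A : Matrix (Fin n) (Fin n) ℝ}
    (hA : IsNilpotent A) : A ∈ closure (shiftOrbit n) := by
  induction n with
  | zero => exact subset_closure ⟨1, 1, one_mul 1, Subsingleton.elim _ _⟩
  | succ n ih =>
    have hdet : A.det = 0 := by
      obtain ⟨k, hk⟩ := hA
      refine eq_zero_of_pow_eq_zero (n := k) ?_
      rw [← det_pow, hk, det_zero]
    obtain ⟨v, hv, hAv⟩ := exists_mulVec_eq_zero_iff.mpr hdet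
    obtain ⟨g, hg, hgv⟩ := exists_isUnit_det_col_zero hv
    have hgi := mul_nonsing_inv g hg
    have hig := nonsing_inv_mul g hg
    set D := g⁻¹ * A * g with hD
    have hAD : A = g * D * g⁻¹ := by
      rw [hD, mul_assoc, mul_assoc, mul_assoc, hgi, mul_one, ← mul_assoc, hgi, one_mul]
    have hD0 : ∀ i, D i 0 = 0 := by
      intro i
      have h1 : (A * g) *ᵥ Pi.single 0 1 = 0 := by
        rw [← mulVec_mulVec, mulVec_single_one]
        have : g.col 0 = v := funext hgv
        rw [this, hAv]
      have h2 : D *ᵥ Pi.single 0 1 = 0 := by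
        rw [hD, mul_assoc, ← mulVec_mulVec, h1, mulVec_zero]
      rw [mulVec_single_one] at h2
      exact congrFun h2 i
    have hblock : D = block 0 (fun j => D 0 j.succ) (D.submatrix Fin.succ Fin.succ) := by
      ext i j
      refine Fin.cases ?_ (fun i => ?_) i <;> refine Fin.cases ?_ (fun j => ?_) j <;> simp [hD0]
    have hDnil : IsNilpotent D := by
      obtain ⟨k, hk⟩ := hA
      refine ⟨k, ?_⟩
      have : ∀ m, D ^ m = g⁻¹ * A ^ m * g := by
        intro m
        induction m with
        | zero => simp [hig]
        | succ m ihm =>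
          rw [pow_succ, ihm, hD, pow_succ]
          calc g⁻¹ * A ^ m * g * (g⁻¹ * A * g) = g⁻¹ * A ^ m * (g * g⁻¹) * A * g := by
                simp only [mul_assoc]
            _ = g⁻¹ * (A ^ m * A) * g := by rw [hgi, mul_one]; simp only [mul_assoc]
      rw [this, hk, mul_zero, zero_mul]
    rw [hAD]
    refine conj_mem_closure_shiftOrbit hgi ?_
    rw [hblock] at hDnil ⊢
    exact block_mem_closure _ (ih (isNilpotent_of_block _ _ _ hDnil))

theorem isNilpotent_mem_closure_charpolyCone {n : ℕ} {A : Matrix (Fin n) (Fin n) ℝ}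
    (hA : IsNilpotent A) {p : ℝ[X]} (hp : p.Monic) (hn : p.natDegree = n) :
    A ∈ closure (charpolyCone n p) :=
  closure_minimal (shiftOrbit_subset_closure_charpolyCone hp hn) isClosed_closure
    (isNilpotent_mem_closure_shiftOrbit hA)

/-- Entrywise perturbations along the support of `A` combined with infinitesimal similarities. -/
def tangentMap {n : ℕ} (A : Matrix (Fin n) (Fin n) ℝ) :
    (Matrix (Fin n) (Fin n) ℝ × Matrix (Fin n) (Fin n) ℝ) →ₗ[ℝ] Matrix (Fin n) (Fin n) ℝ where
  toFun q := A ⊙ q.1 + (q.2 * A - A * q.2)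
  map_add' q q' := by
    simp only [Prod.fst_add, Prod.snd_add, hadamard_add, add_mul, mul_add]
    abel
  map_smul' c q := by
    simp [hadamard_smul, smul_add, smul_sub]

theorem tangentMap_surjective {n : ℕ} {A : Matrix (Fin n) (Fin n) ℝ} (hA : HasNSSP A) :
    Function.Surjective (tangentMap A) := by
  rw [← LinearMap.range_eq_top]
  by_contra hne
  obtain ⟨f, hf, hle⟩ := Submodule.exists_le_ker_of_lt_top _ (lt_top_iff_ne_top.mpr hne)
  have hker : ∀ q, f (tangentMap A q) = 0 := fun q => hle ⟨q, rfl⟩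
  let X : Matrix (Fin n) (Fin n) ℝ := of fun i j => f (single i j 1)
  have hfX : ∀ Y, f Y = ∑ i, ∑ j, Y i j * X i j := by
    intro Y
    conv_lhs => rw [matrix_eq_sum_single Y]
    simp only [map_sum]
    refine Finset.sum_congr rfl fun i _ => Finset.sum_congr rfl fun j _ => ?_
    have : single i j (Y i j) = Y i j • single i j (1 : ℝ) := by simp [smul_single]
    rw [this, map_smul, smul_eq_mul]
    rfl
  have hX : X = 0 := by
    refine hA X (fun i j => ?_) ?_
    · have h := hker (single i j 1, 0)
      have h1 : tangentMap A (single i j 1, 0) = A i j • single i j (1 : ℝ) := by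
        ext a b
        by_cases hab : i = a ∧ j = b
        · obtain ⟨rfl, rfl⟩ := hab
          simp [tangentMap]
        · simp [tangentMap, hab]
      rw [h1, map_smul, smul_eq_mul] at h
      exact h
    · ext b a
      have h := hker (0, single a b 1)
      rw [hfX] at h
      simp only [tangentMap, LinearMap.coe_mk, AddHom.coe_mk, hadamard_zero, zero_add,
        Matrix.sub_apply, sub_mul, Finset.sum_sub_distrib, sub_eq_zero] at h
      rw [mul_apply, mul_apply]
      have h1 : ∑ i, ∑ j, (single a b (1 : ℝ) * A) i j * X i j = ∑ j, A b j * Xᵀ j a := by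
        rw [Finset.sum_eq_single a]
        · simp
        · intro i _ hi
          simp [single_mul_apply_of_ne, hi]
        · simp
      have h2 : ∑ i, ∑ j, (A * single a b (1 : ℝ)) i j * X i j = ∑ i, Xᵀ b i * A i a := by
        refine Finset.sum_congr rfl fun i _ => ?_
        rw [Finset.sum_eq_single b]
        · simp [mul_comm]
        · intro j _ hj
          simp [mul_single_apply_of_ne, hj]
        · simp
      rw [← h1, ← h2, h]
  refine hf (LinearMap.ext fun Y => ?_)
  simp [hfX, hX]

/-- If perturbations `H B` together with commutators `L * a - a * L` span a Banach algebra, then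
every element near `a` is conjugate, through an element near `1`, to one of the form
`a + H B + ε • S`, for all small `ε`. -/
theorem eventually_exists_mul_eq_mul {R : Type*} [NormedRing R] [NormedAlgebra ℝ R]
    [CompleteSpace R] (H : R →L[ℝ] R) (a S : R)
    (hsurj : ∀ Y : R, ∃ B L : R, H B + (L * a - a * L) = Y) {U : Set (R × R)}
    (hU : U ∈ 𝓝 0) :
    ∀ᶠ q : R × ℝ in 𝓝 (a, 0), ∃ x ∈ U,
      (1 + x.2) * (a + H x.1 + q.2 • S) = q.1 * (1 + x.2) := by
  let pp := ContinuousLinearMap.fst ℝ (R × R) (R × ℝ)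
  let pq := ContinuousLinearMap.snd ℝ (R × R) (R × ℝ)
  let pB := (ContinuousLinearMap.fst ℝ R R).comp pp
  let pL := (ContinuousLinearMap.snd ℝ R R).comp pp
  let pT := (ContinuousLinearMap.fst ℝ R ℝ).comp pq
  let pe := (ContinuousLinearMap.snd ℝ R ℝ).comp pq
  let x₀ : (R × R) × (R × ℝ) := (0, (a, 0))
  have hV : HasStrictFDerivAt (fun x => 1 + pL x) pL x₀ := pL.hasStrictFDerivAt.const_add 1
  have hW : HasStrictFDerivAt (fun x => a + (H.comp pB + pe.smulRight S) x)
      (H.comp pB + pe.smulRight S) x₀ :=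
    (H.comp pB + pe.smulRight S).hasStrictFDerivAt.const_add a
  have hG := ((hV.mul' hW).sub (pT.hasStrictFDerivAt.mul' hV)).prodMk
    (pq.hasStrictFDerivAt (x := x₀))
  have hmap := hG.map_nhds_eq_of_surj (by
    rw [LinearMap.range_eq_top]
    rintro ⟨Y, T, e⟩
    obtain ⟨B, L, hBL⟩ := hsurj (Y - e • S + T)
    refine ⟨((B, L), (T, e)), Prod.ext ?_ rfl⟩
    have hval : Y = H B + e • S + L * a - (a * L + T) := by
      rw [← sub_eq_zero] at hBL
      rw [eq_comm, ← sub_eq_zero, ← hBL]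
      abel
    rw [hval]
    simp [x₀, pL, pB, pT, pe, pq, pp])
  have him := Filter.image_mem_map
    (m := fun x => ((1 + pL x) * (a + (H.comp pB + pe.smulRight S) x) - pT x * (1 + pL x), pq x))
    (pp.continuous.continuousAt.preimage_mem_nhds (x := x₀) hU)
  have hx₀ : ((1 + pL x₀) * (a + (H.comp pB + pe.smulRight S) x₀) - pT x₀ * (1 + pL x₀), pq x₀)
      = ((0 : R), ((a, 0) : R × ℝ)) := by
    simp [pL, pB, pT, pe, pq, pp, x₀]
  have hmap' : Filter.map (fun x => ((1 + pL x) * (a + (H.comp pB + pe.smulRight S) x)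
      - pT x * (1 + pL x), pq x)) (𝓝 x₀) = 𝓝 ((0 : R), ((a, 0) : R × ℝ)) := hx₀ ▸ hmap
  rw [hmap'] at him
  have hcont : Continuous fun q : R × ℝ => ((0 : R), q) := by fun_prop
  filter_upwards [hcont.continuousAt.preimage_mem_nhds him] with q hq
  obtain ⟨x, hxU, hxq⟩ := hq
  have h1 := congrArg Prod.fst hxq
  have h2 : pq x = q := congrArg Prod.snd hxq
  refine ⟨pp x, hxU, ?_⟩
  rw [← h2, add_assoc]
  exact sub_eq_zero.mp h1

section deformation

attribute [local instance] Matrix.linftyOpNormedRing Matrix.linftyOpNormedAlgebra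

theorem eventually_exists_similar {n : ℕ} {A : Matrix (Fin n) (Fin n) ℝ} (hA : HasNSSP A)
    (S : Matrix (Fin n) (Fin n) ℝ) :
    ∀ᶠ q : Matrix (Fin n) (Fin n) ℝ × ℝ in 𝓝 (A, 0),
      ∃ B L : Matrix (Fin n) (Fin n) ℝ, (∀ i j, |B i j| < 1) ∧ IsUnit (1 + L).det ∧
        (1 + L) * (A + A ⊙ B + q.2 • S) = q.1 * (1 + L) := by
  let H : Matrix (Fin n) (Fin n) ℝ →L[ℝ] Matrix (Fin n) (Fin n) ℝ :=
    LinearMap.toContinuousLinearMap ((tangentMap A).comp (LinearMap.inl ℝ _ _))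
  have hH : ∀ B, H B = A ⊙ B := fun B => by simp [H, tangentMap]
  have hU : {x : Matrix (Fin n) (Fin n) ℝ × Matrix (Fin n) (Fin n) ℝ |
      (∀ i j, |x.1 i j| < 1) ∧ IsUnit (1 + x.2).det} ∈ 𝓝 0 := by
    refine Filter.Eventually.and (Filter.eventually_all.mpr fun i =>
      Filter.eventually_all.mpr fun j => ?_) ?_
    · have hc : Continuous fun x : Matrix (Fin n) (Fin n) ℝ × Matrix (Fin n) (Fin n) ℝ =>
          |x.1 i j| := (continuous_fst.matrix_elem i j).abs
      exact hc.continuousAt.eventually_lt continuousAt_const (by simp)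
    · have hc : Continuous fun x : Matrix (Fin n) (Fin n) ℝ × Matrix (Fin n) (Fin n) ℝ =>
          (1 + x.2).det := (continuous_const.add continuous_snd).matrix_det
      have h0 : (1 + (0 : Matrix (Fin n) (Fin n) ℝ × Matrix (Fin n) (Fin n) ℝ).2).det ≠ 0 := by
        simp
      filter_upwards [hc.continuousAt.eventually_ne h0] with x hx
      exact isUnit_iff_ne_zero.mpr hx
  have hsurj : ∀ Y, ∃ B L, H B + (L * A - A * L) = Y := fun Y => by
    obtain ⟨⟨B, L⟩, h⟩ := tangentMap_surjective hA Y
    exact ⟨B, L, by rw [hH]; exact h⟩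
  filter_upwards [eventually_exists_mul_eq_mul H A S hsurj hU] with q ⟨x, ⟨hB, hL⟩, hx⟩
  exact ⟨x.1, x.2, hB, hL, by rw [← hH]; exact hx⟩

end deformation

theorem sign_perturbation {n : ℕ} {P P' : Fin n → Fin n → SignType}
    {A B : Matrix (Fin n) (Fin n) ℝ} (hA : qMem P A) (hP : ∀ i j, P i j ≠ 0 → P' i j = P i j)
    (hB : ∀ i j, |B i j| < 1) {ε : ℝ} (hε : 0 < ε) :
    qMem P' (A + A ⊙ B + ε • of fun i j => if A i j = 0 then (P' i j : ℝ) else 0) := by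
  intro i j
  by_cases h : A i j = 0
  · simp only [Matrix.add_apply, hadamard_apply, Matrix.smul_apply, of_apply, h, if_true, zero_mul,
      zero_add, add_zero, smul_eq_mul, sign_mul, sign_pos hε, one_mul]
    cases P' i j <;> simp
  · have hPA : P i j ≠ 0 := by rw [← hA i j]; exact sign_ne_zero.mpr h
    have hpos : 0 < 1 + B i j := by linarith [neg_lt_of_abs_lt (hB i j)]
    have : (A + A ⊙ B + ε • of fun i j => if A i j = 0 then (P' i j : ℝ) else 0) i j
        = A i j * (1 + B i j) := by
      simp [h, mul_add]
    rw [this, sign_mul, sign_pos hpos, mul_one, hA i j, hP i j hPA]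

end NilpotentNSSP

/-- Corollary 16 (flexible nilpotent-centralizer method): if `A ∈ Q(P)` is nilpotent
and has the nSSP, then every superpattern of `P` is spectrally arbitrary. -/
theorem nilpotent_nssp_spectrally_arbitrary (n : ℕ) (P : Fin n → Fin n → SignType)
    (A : Matrix (Fin n) (Fin n) ℝ) (hA : qMem P A)
    (hnil : IsNilpotent A) (hnssp : HasNSSP A) :
    ∀ P' : Fin n → Fin n → SignType, (∀ i j, P i j ≠ 0 → P' i j = P i j) →
      SpectrallyArbitrary P' := by
  intro P' hP p hp hn
  have hev := NilpotentNSSP.eventually_exists_similar hnssp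
    (of fun i j => if A i j = 0 then (P' i j : ℝ) else 0)
  rw [nhds_prod_eq] at hev
  obtain ⟨T, ⟨t, ht, hT⟩, hTev⟩ := ((mem_closure_iff_frequently.mp
    (NilpotentNSSP.isNilpotent_mem_closure_charpolyCone hnil hp hn)).and_eventually hev.curry).exists
  obtain ⟨ε, ⟨B, L, hB, hL, hsim⟩, hε⟩ :=
    ((hTev.filter_mono (nhdsWithin_le_nhds (s := Set.Ioi 0))).and self_mem_nhdsWithin).exists
  have hM := NilpotentNSSP.sign_perturbation hA hP hB hε
  set M := A + A ⊙ B + ε • of fun i j => if A i j = 0 then (P' i j : ℝ) else 0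
  refine ⟨t • M, fun i j => ?_, ?_⟩
  · rw [Matrix.smul_apply, smul_eq_mul, sign_mul, sign_pos ht, one_mul]
    exact hM i j
  · have hinv := mul_nonsing_inv (1 + L) hL
    have hTM : t • T = (1 + L) * (t • M) * (1 + L)⁻¹ := by
      rw [mul_smul_comm, smul_mul_assoc, hsim, mul_assoc, hinv, mul_one]
    rw [← NilpotentNSSP.charpoly_conj hinv (t • M), ← hTM, hT]
end

section
/- Let P be an n×n sign pattern and let A ∈ Q(P). Suppose every eigenvalue of A (over ℂ) has real part zero, the algebraic multiplicity of 0 as an eigenvalue of A is at least 2, and A has the non-symmetric strong spectral property (nSSP). Then P is an inertially arbitrary pattern. -/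
open Matrix Polynomial

/-- The characteristic polynomial is multiplicative along an invariant subspace. -/
theorem charpoly_eq_restrict_mul_mapQ {K V : Type*} [Field K] [Infinite K] [AddCommGroup V]
    [Module K V] [FiniteDimensional K V] (f : Module.End K V) (W : Submodule K V)
    (hW : W ≤ W.comap f) :
    f.charpoly = (f.restrict hW).charpoly * (W.mapQ W f hW).charpoly := by
  refine Polynomial.funext fun t => ?_
  have ht : W ≤ W.comap (algebraMap K (Module.End K V) t - f) := fun w hw => by
    simpa [Module.algebraMap_end_apply] using W.sub_mem (W.smul_mem t hw) (hW hw)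
  rw [eval_mul, LinearMap.eval_charpoly, LinearMap.eval_charpoly, LinearMap.eval_charpoly,
    LinearMap.det_eq_det_mul_det W _ ht]
  congr 2
  refine LinearMap.ext fun u => ?_
  obtain ⟨u, rfl⟩ := W.mkQ_surjective u
  rfl

/-- An irreducible factor of the characteristic polynomial evaluates to a singular
endomorphism. -/
theorem exists_aeval_apply_eq_zero {V : Type*} [AddCommGroup V] [Module ℝ V]
    [FiniteDimensional ℝ V] (f : Module.End ℝ V) {q : ℝ[X]} (hq : Irreducible q)
    (hdvd : q ∣ f.charpoly) : ∃ v ≠ 0, aeval f q v = 0 := by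
  obtain ⟨z, hz⟩ := Complex.exists_root (f := q.map (algebraMap ℝ ℂ))
    (by rw [degree_map]; exact hq.degree_pos)
  have hroot : (LinearMap.charpoly (f.baseChange ℂ)).IsRoot z := by
    rw [LinearMap.charpoly_baseChange]
    exact hz.dvd (Polynomial.map_dvd _ hdvd)
  obtain ⟨w, hw⟩ :=
    ((Module.End.hasEigenvalue_iff_isRoot_charpoly _ _).2 hroot).exists_hasEigenvector
  have hbase : (aeval f q).baseChange ℂ = aeval (f.baseChange ℂ) (q.map (algebraMap ℝ ℂ)) := by
    rw [aeval_map_algebraMap]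
    exact (aeval_algHom_apply (Module.End.baseChangeHom ℝ ℂ V) f q).symm
  have hw0 : (aeval f q).baseChange ℂ w = 0 := by
    rw [hbase, Module.End.aeval_apply_of_hasEigenvector hw, hz.eq_zero, zero_smul]
  have hdet : LinearMap.det (aeval f q) = 0 := by
    have h : LinearMap.det ((aeval f q).baseChange ℂ) = 0 := by
      by_contra hne
      have hinj := LinearMap.ker_eq_bot.1
        (by simpa using (LinearMap.equivOfDetNeZero _ hne).ker)
      exact hw.2 (hinj (by rw [hw0, map_zero]))
    rw [LinearMap.det_baseChange] at h
    simpa using h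
  obtain ⟨v, hv, hv0⟩ := (Submodule.ne_bot_iff _).1 (LinearMap.bot_lt_ker_of_det_eq_zero hdet).ne'
  exact ⟨v, hv0, hv⟩

/-- An irreducible monic factor of the characteristic polynomial is the characteristic polynomial
of the restriction to an invariant subspace. -/
theorem exists_restrict_charpoly_eq {V : Type*} [AddCommGroup V] [Module ℝ V]
    [FiniteDimensional ℝ V] (f : Module.End ℝ V) {q : ℝ[X]} (hq : Irreducible q) (hm : q.Monic)
    (hdvd : q ∣ f.charpoly) :
    ∃ (W : Submodule ℝ V) (hW : W ≤ W.comap f), (f.restrict hW).charpoly = q := by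
  obtain ⟨v, hv, hqv⟩ := exists_aeval_apply_eq_zero f hq hdvd
  let φ : ℝ[X] →ₗ[ℝ] V := (LinearMap.applyₗ v).comp (aeval f).toLinearMap
  have hφ (p : ℝ[X]) : φ p = aeval f p v := rfl
  have hφX (p : ℝ[X]) : φ (X * p) = f (φ p) := by simp [hφ]
  have hW : LinearMap.range φ ≤ (LinearMap.range φ).comap f := by
    rintro _ ⟨p, rfl⟩
    exact ⟨X * p, hφX p⟩
  refine ⟨LinearMap.range φ, hW, ?_⟩
  set g : Module.End ℝ (LinearMap.range φ) := f.restrict (p := LinearMap.range φ) hW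
  have hmod (p : ℝ[X]) : φ (p %ₘ q) = φ p := by
    conv_rhs => rw [← modByMonic_add_div p q, mul_comm]
    simp [hφ, hqv]
  have hrange : LinearMap.range φ = (degreeLT ℝ q.natDegree).map φ := by
    refine le_antisymm ?_ (LinearMap.map_le_range)
    rintro _ ⟨p, rfl⟩
    refine ⟨p %ₘ q, ?_, hmod p⟩
    simpa [mem_degreeLT, ← degree_eq_natDegree hm.ne_zero] using degree_modByMonic_lt p hm
  have hfin : Module.finrank ℝ (LinearMap.range φ) ≤ q.natDegree := by
    have := (degreeLTEquiv ℝ q.natDegree).symm.finiteDimensional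
    rw [hrange]
    refine (Submodule.finrank_map_le _ _).trans ?_
    simp [(degreeLTEquiv ℝ q.natDegree).finrank_eq]
  have : Nontrivial (LinearMap.range φ) :=
    ⟨⟨v, 1, by simp [hφ]⟩, 0, fun h => hv (congrArg Subtype.val h)⟩
  have hgpow (p : ℝ[X]) (w : LinearMap.range φ) : (aeval g p w : V) = aeval f p w := by
    induction p using Polynomial.induction_on' with
    | add p r hp hr => simp [hp, hr]
    | monomial k a =>
      simp [aeval_monomial, g, Module.End.pow_restrict k, LinearMap.coe_restrict_apply]
  have hgq : aeval g q = 0 := by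
    refine LinearMap.ext fun w => Subtype.ext ?_
    obtain ⟨p, hp⟩ := w.2
    rw [hgpow, ← hp, hφ, ← Module.End.mul_apply, ← map_mul, mul_comm, map_mul,
      Module.End.mul_apply, hqv, map_zero]
    rfl
  have hmin : minpoly ℝ g = q := (minpoly.eq_of_irreducible_of_monic hq hgq hm).symm
  refine (eq_of_monic_of_dvd_of_natDegree_le hm g.charpoly_monic ?_ ?_)
  · rw [← hmin]
    exact LinearMap.minpoly_dvd_charpoly g
  · rwa [LinearMap.charpoly_natDegree]

/-- Along a line through a real endomorphism, the irreducible factors of the characteristic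
polynomial can be translated independently of each other. -/
theorem exists_charpoly_add_smul {V : Type*} [AddCommGroup V] [Module ℝ V]
    [FiniteDimensional ℝ V] (T : Multiset (ℝ[X] × ℝ)) (f : Module.End ℝ V)
    (hT : ∀ x ∈ T, Irreducible x.1 ∧ x.1.Monic) (hf : f.charpoly = (T.map Prod.fst).prod) :
    ∃ N : Module.End ℝ V, ∀ ε : ℝ,
      (f + ε • N).charpoly = (T.map fun x => x.1.comp (X - C (ε * x.2))).prod := by
  induction T using Multiset.induction_on generalizing V with
  | empty =>
    refine ⟨0, fun ε => ?_⟩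
    simpa using hf
  | cons x T ih =>
    obtain ⟨hq, hm⟩ := hT x (Multiset.mem_cons_self x T)
    rw [Multiset.map_cons, Multiset.prod_cons] at hf
    obtain ⟨W, hW, hWq⟩ := exists_restrict_charpoly_eq f hq hm (hf ▸ dvd_mul_right _ _)
    have hquot : (W.mapQ W f hW).charpoly = (T.map Prod.fst).prod := by
      rw [charpoly_eq_restrict_mul_mapQ f W hW, hWq] at hf
      exact mul_left_cancel₀ hm.ne_zero hf
    obtain ⟨N₀, hN₀⟩ := ih _ (fun y hy => hT y (Multiset.mem_cons_of_mem hy)) hquot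
    obtain ⟨π, hπ⟩ := W.subtype.exists_leftInverse_of_injective W.ker_subtype
    obtain ⟨σ, hσ⟩ := W.mkQ.exists_rightInverse_of_surjective W.range_mkQ
    have hπ' (w : W) : π w = w := LinearMap.congr_fun hπ w
    have hσ' (u : V ⧸ W) : W.mkQ (σ u) = u := LinearMap.congr_fun hσ u
    let N : Module.End ℝ V := x.2 • (W.subtype ∘ₗ π) + σ ∘ₗ N₀ ∘ₗ W.mkQ
    have hNW (w : W) : N w = x.2 • (w : V) := by
      have h0 : W.mkQ (w : V) = 0 := by simp
      simp only [N, LinearMap.add_apply, LinearMap.smul_apply, LinearMap.comp_apply, hπ', h0,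
        map_zero, add_zero, Submodule.subtype_apply]
    have hNQ (u : V) : W.mkQ (N u) = N₀ (W.mkQ u) := by
      have h0 : W.mkQ (π u : V) = 0 := by simp
      simp only [N, LinearMap.add_apply, LinearMap.smul_apply, LinearMap.comp_apply, hσ', h0,
        map_add, map_smul, smul_zero, zero_add, Submodule.subtype_apply]
    refine ⟨N, fun ε => ?_⟩
    have hε : W ≤ W.comap (f + ε • N) := fun w hw => by
      have := hNW ⟨w, hw⟩
      simp only at this
      simpa [this] using W.add_mem (hW hw) (W.smul_mem ε (W.smul_mem x.2 hw))
    have hres : (f + ε • N).restrict hε = f.restrict hW - (-(ε * x.2)) • 1 := by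
      ext w
      simp [hNW, mul_smul]
    have hmap : W.mapQ W (f + ε • N) hε = W.mapQ W f hW + ε • N₀ := by
      refine LinearMap.ext fun u => ?_
      obtain ⟨u, rfl⟩ := W.mkQ_surjective u
      rw [LinearMap.add_apply, LinearMap.smul_apply, ← hNQ]
      rfl
    rw [charpoly_eq_restrict_mul_mapQ _ W hε, hres, hmap, hN₀, LinearMap.charpoly_sub_smul, hWq,
      Multiset.map_cons, Multiset.prod_cons, C_neg, ← sub_eq_add_neg]

section Similarity

open Filter Topology

attribute [local instance] Matrix.linftyOpNormedRing Matrix.linftyOpNormedAlgebra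

/-- The nSSP says that commutators with `A` together with matrices supported on the pattern of `A`
span all matrices. -/
theorem HasNSSP.exists_commutator_add_hadamard {n : ℕ} {A : Matrix (Fin n) (Fin n) ℝ}
    (h : HasNSSP A) (M : Matrix (Fin n) (Fin n) ℝ) :
    ∃ K W : Matrix (Fin n) (Fin n) ℝ, A * K - K * A + A ⊙ W = M := by
  let L : Matrix (Fin n) (Fin n) ℝ × Matrix (Fin n) (Fin n) ℝ →ₗ[ℝ] Matrix (Fin n) (Fin n) ℝ :=
    { toFun := fun p => A * p.1 - p.1 * A + A ⊙ p.2
      map_add' := fun p q => by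
        simp only [Prod.fst_add, Prod.snd_add, mul_add, add_mul, hadamard_add]
        abel
      map_smul' := fun c p => by
        simp [smul_sub, hadamard_smul] }
  suffices hL : LinearMap.range L = ⊤ by
    obtain ⟨⟨K, W⟩, hKW⟩ := (LinearMap.range_eq_top.1 hL) M
    exact ⟨K, W, hKW⟩
  by_contra hL
  obtain ⟨φ, hφ0, hφ⟩ := Submodule.exists_le_ker_of_lt_top _ (lt_top_iff_ne_top.2 hL)
  have hφL (K W) : φ (A * K - K * A + A ⊙ W) = 0 := hφ ⟨(K, W), rfl⟩
  let Y : Matrix (Fin n) (Fin n) ℝ := of fun i j => φ (single i j 1)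
  have hφY (M) : φ M = trace (Yᵀ * M) := by
    conv_lhs => rw [matrix_eq_sum_single M]
    simp only [map_sum, trace, diag_apply, mul_apply, transpose_apply, Y, of_apply]
    rw [Finset.sum_comm]
    refine Finset.sum_congr rfl fun j _ => Finset.sum_congr rfl fun i _ => ?_
    rw [show single i j (M i j) = M i j • single i j (1 : ℝ) by simp, map_smul, smul_eq_mul,
      mul_comm]
  have hY : Y = 0 := by
    refine h Y (fun i j => ?_) ?_
    · have := hφL 0 (single i j 1)
      rw [mul_zero, zero_mul, sub_zero, zero_add,
        show A ⊙ single i j 1 = A i j • single i j (1 : ℝ) by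
          ext a b
          by_cases hab : i = a ∧ j = b
          · obtain ⟨rfl, rfl⟩ := hab
            simp
          · simp [hab], map_smul] at this
      exact this
    · refine ext_iff_trace_mul_right.2 fun K => ?_
      have := hφL K 0
      rw [hadamard_zero, add_zero, hφY, mul_sub, trace_sub, sub_eq_zero, ← mul_assoc,
        ← mul_assoc, trace_mul_comm (Yᵀ * K), ← mul_assoc] at this
      exact this.symm
  refine hφ0 (LinearMap.ext fun M => ?_)
  rw [hφY, hY]
  simp

/-- If `A` has the nSSP, then every matrix near `A` has the characteristic polynomial of some
matrix with the sign pattern of `A`. -/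
theorem HasNSSP.eventually_exists_charpoly_eq {n : ℕ} {P : Fin n → Fin n → SignType}
    {A : Matrix (Fin n) (Fin n) ℝ} (h : HasNSSP A) (hA : qMem P A) :
    ∀ᶠ M in 𝓝 A, ∃ B, qMem P B ∧ B.charpoly = M.charpoly := by
  let E := Matrix (Fin n) (Fin n) ℝ
  let J : E := of fun _ _ => 1
  let had : E →L[ℝ] E := LinearMap.toContinuousLinearMap
    { toFun := fun W => A ⊙ W
      map_add' := fun _ _ => hadamard_add ..
      map_smul' := fun _ _ => hadamard_smul .. }
  have hJ : had J = A := by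
    ext i j
    simp [had, J]
  let F : E × E → E := fun p => Ring.inverse (1 + p.1) * had p.2 * (1 + p.1)
  have hF0 : F (0, J) = A := by simp [F, hJ]
  have h1 : HasStrictFDerivAt (fun p : E × E => 1 + p.1) (ContinuousLinearMap.fst ℝ E E) (0, J) :=
    hasStrictFDerivAt_fst.const_add 1
  have h2 : HasStrictFDerivAt (fun p : E × E => had p.2)
      (had.comp (ContinuousLinearMap.snd ℝ E E)) (0, J) :=
    had.hasStrictFDerivAt.comp _ hasStrictFDerivAt_snd
  have h3 : HasStrictFDerivAt (fun p : E × E => Ring.inverse (1 + p.1))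
      (-ContinuousLinearMap.fst ℝ E E) (0, J) := by
    have hinv := hasStrictFDerivAt_ringInverse (𝕜 := ℝ) (1 : Eˣ)
    rw [show ((1 : Eˣ) : E) = 1 + ((0, J) : E × E).1 by simp] at hinv
    refine (HasStrictFDerivAt.comp (f := fun p : E × E => 1 + p.1) (0, J) hinv h1).congr_fderiv ?_
    refine ContinuousLinearMap.ext fun p => ?_
    change -((1 : E) * p.1 * 1) = -p.1
    rw [one_mul, mul_one]
  have hF := (h3.mul' h2).mul' h1
  have hmap := hF.map_nhds_eq_of_surj (LinearMap.range_eq_top.2 fun M => by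
    obtain ⟨K, W, hKW⟩ := h.exists_commutator_add_hadamard M
    refine ⟨(K, W), ?_⟩
    rw [← hKW]
    simp [hJ]
    change A * K + (1 * (A ⊙ W) + -K * A) = _
    rw [one_mul, neg_mul]
    abel)
  change Filter.map F _ = 𝓝 (F (0, J)) at hmap
  rw [hF0] at hmap
  rw [← hmap, eventually_map]
  have hunit : ∀ᶠ p : E × E in 𝓝 (0, J), IsUnit (1 + p.1) := by
    refine (h1.continuousAt.tendsto).eventually (Units.isOpen.mem_nhds ?_)
    simp
  have hpos : ∀ᶠ p : E × E in 𝓝 (0, J), ∀ i j, 0 < p.2 i j := by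
    refine eventually_all.2 fun i => eventually_all.2 fun j => ?_
    have hc : Continuous fun p : E × E => p.2 i j := by fun_prop
    refine hc.continuousAt.tendsto.eventually (lt_mem_nhds ?_)
    simp [J]
  filter_upwards [hunit, hpos] with p hp1 hp2
  refine ⟨A ⊙ p.2, fun i j => ?_, ?_⟩
  · rw [hadamard_apply, sign_mul, sign_pos (hp2 i j), mul_one, hA i j]
  · obtain ⟨u, hu⟩ := hp1
    simp only [F, ← hu, Ring.inverse_unit]
    rw [coe_units_inv]
    exact (charpoly_units_conj' u _).symm

end Similarity

/-- Signs can be attached to polynomials of degree two and to at least two copies of `X` so that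
the degrees carrying each sign add up to prescribed numbers. -/
theorem exists_sign_assignment (Q : Multiset ℝ[X]) (hQ : ∀ q ∈ Q, q.natDegree = 2) {m : ℕ}
    (hm : 2 ≤ m) {np nm nz : ℕ} (hn : np + nm + nz = m + 2 * Q.card) :
    ∃ T : Multiset (ℝ[X] × ℝ), T.map Prod.fst = Q + Multiset.replicate m X ∧
      (T.map fun x => if 0 < x.2 then x.1.natDegree else 0).sum = np ∧
      (T.map fun x => if x.2 < 0 then x.1.natDegree else 0).sum = nm ∧
      (T.map fun x => if x.2 = 0 then x.1.natDegree else 0).sum = nz := by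
  induction Q using Multiset.induction_on generalizing np nm nz with
  | empty =>
    refine ⟨Multiset.replicate np (X, 1) + Multiset.replicate nm (X, -1) +
      Multiset.replicate nz (X, 0), ?_, ?_, ?_, ?_⟩
    · simp_all [← Multiset.replicate_add]
    all_goals norm_num
  | cons q Q ih =>
    have hq := hQ q (Multiset.mem_cons_self q Q)
    have ih' {a b c : ℕ} := ih (np := a) (nm := b) (nz := c)
      fun r hr => hQ r (Multiset.mem_cons_of_mem hr)
    rw [Multiset.card_cons] at hn
    obtain h | h | h : 2 ≤ np ∨ 2 ≤ nm ∨ 2 ≤ nz := by omega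
    · obtain ⟨T, hT, h1, h2, h3⟩ := ih' (a := np - 2) (b := nm) (c := nz) (by omega)
      exact ⟨(q, 1) ::ₘ T, by simp [hT], by norm_num [h1, hq]; omega, by norm_num [h2],
        by norm_num [h3]⟩
    · obtain ⟨T, hT, h1, h2, h3⟩ := ih' (a := np) (b := nm - 2) (c := nz) (by omega)
      exact ⟨(q, -1) ::ₘ T, by simp [hT], by norm_num [h1], by norm_num [h2, hq]; omega,
        by norm_num [h3]⟩
    · obtain ⟨T, hT, h1, h2, h3⟩ := ih' (a := np) (b := nm) (c := nz - 2) (by omega)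
      exact ⟨(q, 0) ::ₘ T, by simp [hT], by norm_num [h1], by norm_num [h2],
        by norm_num [h3, hq]; omega⟩

theorem roots_comp_X_sub_C {R : Type*} [CommRing R] [IsDomain R] (p : R[X]) (a : R) :
    (p.comp (X - C a)).roots = p.roots.map (· + a) := by
  classical
  ext z
  obtain ⟨w, rfl⟩ : ∃ w, w + a = z := ⟨z - a, sub_add_cancel z a⟩
  rw [Multiset.count_map_eq_count' (· + a) _ (add_left_injective a), count_roots, count_roots,
    rootMultiplicity_eq_rootMultiplicity, rootMultiplicity_eq_rootMultiplicity (t := w), comp_assoc]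
  simp [add_sub_assoc, add_comm]

/-- Translating polynomials with purely imaginary roots moves all of their roots to prescribed
vertical lines. -/
theorem card_filter_roots_prod_comp (T : Multiset (ℝ[X] × ℝ)) (ε : ℝ)
    (hm : ∀ x ∈ T, x.1.Monic)
    (hre : ∀ x ∈ T, ∀ z ∈ (x.1.map (algebraMap ℝ ℂ)).roots, z.re = 0)
    (p : ℝ → Prop) [DecidablePred p] :
    ((((T.map fun x : ℝ[X] × ℝ => x.1.comp (X - C (ε * x.2))).prod.map (algebraMap ℝ ℂ)).roots.filter
      fun z => p z.re).card) =
      (T.map fun x : ℝ[X] × ℝ => if p (ε * x.2) then x.1.natDegree else 0).sum := by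
  have hmc (x : ℝ[X] × ℝ) (hx : x ∈ T) : (x.1.comp (X - C (ε * x.2))).Monic :=
    (hm x hx).comp_X_sub_C _
  induction T using Multiset.induction_on with
  | empty => simp
  | cons x T ih =>
    have hx := Multiset.mem_cons_self x T
    have hT {y : ℝ[X] × ℝ} (hy : y ∈ T) := Multiset.mem_cons_of_mem (b := x) hy
    have hprod : (T.map fun x : ℝ[X] × ℝ => x.1.comp (X - C (ε * x.2))).prod.Monic :=
      monic_multiset_prod_of_monic _ _ fun y hy => hmc y (hT hy)
    have hne := (((hmc x hx).mul hprod).map (algebraMap ℝ ℂ)).ne_zero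
    rw [Polynomial.map_mul] at hne
    have hroots : ((x.1.comp (X - C (ε * x.2))).map (algebraMap ℝ ℂ)).roots =
        (x.1.map (algebraMap ℝ ℂ)).roots.map (· + ((ε * x.2 : ℝ) : ℂ)) := by
      rw [Polynomial.map_comp, Polynomial.map_sub, map_X, map_C]
      exact roots_comp_X_sub_C _ _
    have hcard : (x.1.map (algebraMap ℝ ℂ)).roots.card = x.1.natDegree := by
      rw [IsAlgClosed.card_roots_eq_natDegree, natDegree_map]
    rw [Multiset.map_cons, Multiset.prod_cons, Polynomial.map_mul, roots_mul hne,
      Multiset.filter_add, Multiset.card_add, Multiset.map_cons, Multiset.sum_cons,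
      ih (fun y hy => hm y (hT hy)) (fun y hy => hre y (hT hy)) (fun y hy => hmc y (hT hy)), hroots]
    congr 1
    have hline (z) (hz : z ∈ (x.1.map (algebraMap ℝ ℂ)).roots.map (· + ((ε * x.2 : ℝ) : ℂ))) :
        z.re = ε * x.2 := by
      obtain ⟨w, hw, rfl⟩ := Multiset.mem_map.1 hz
      rw [Complex.add_re, hre x hx w hw, Complex.ofReal_re, zero_add]
    rw [Multiset.filter_congr (q := fun _ => p (ε * x.2)) fun z hz => by rw [hline z hz]]
    split_ifs with h <;> simp [h, hcard]

/-- A real irreducible monic polynomial whose complex roots are purely imaginary is `X` or has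
degree two. -/
theorem eq_X_or_natDegree_eq_two {q : ℝ[X]} (hq : Irreducible q) (hm : q.Monic)
    (hre : ∀ z ∈ (q.map (algebraMap ℝ ℂ)).roots, z.re = 0) : q = X ∨ q.natDegree = 2 := by
  have h2 : q.natDegree ≤ 2 := natDegree_le_iff_degree_le.2 hq.degree_le_two
  have h0 := hq.natDegree_pos
  obtain h1 | h1 : q.natDegree = 1 ∨ q.natDegree = 2 := by omega
  · left
    rw [hm.eq_X_add_C h1] at hre ⊢
    have := hre (-(q.coeff 0 : ℂ)) (by
      rw [mem_roots ((monic_X_add_C _).map _).ne_zero]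
      simp)
    have h : q.coeff 0 = 0 := by simpa using this
    simp [h]
  · exact Or.inr h1

/-- A real monic polynomial with purely imaginary roots, zero being at least double, is a product
of irreducible quadratics and at least two copies of `X`. -/
theorem exists_quadratic_factorization {p : ℝ[X]} (hp : p.Monic)
    (hre : ∀ z ∈ (p.map (algebraMap ℝ ℂ)).roots, z.re = 0)
    (h0 : 2 ≤ (p.map (algebraMap ℝ ℂ)).roots.count 0) :
    ∃ (Q : Multiset ℝ[X]) (m : ℕ), 2 ≤ m ∧ (∀ q ∈ Q, q.natDegree = 2) ∧
      (∀ q ∈ Q + Multiset.replicate m X, Irreducible q ∧ q.Monic ∧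
        ∀ z ∈ (q.map (algebraMap ℝ ℂ)).roots, z.re = 0) ∧
      (Q + Multiset.replicate m X).prod = p := by
  classical
  let F := UniqueFactorizationMonoid.normalizedFactors p
  have hF : F.filter (· ≠ X) + Multiset.replicate (F.count X) X = F := by
    rw [← Multiset.filter_eq', add_comm, Multiset.filter_add_not]
  have hprod : F.prod = p :=
    (UniqueFactorizationMonoid.prod_normalizedFactors_eq hp.ne_zero).trans hp.normalize_eq_self
  have hmem (q) (hq : q ∈ F) : Irreducible q ∧ q.Monic ∧
      ∀ z ∈ (q.map (algebraMap ℝ ℂ)).roots, z.re = 0 := by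
    have hirr := UniqueFactorizationMonoid.irreducible_of_normalized_factor q hq
    refine ⟨hirr, ?_, fun z hz => hre z ?_⟩
    · rw [← UniqueFactorizationMonoid.normalize_normalized_factor q hq]
      exact monic_normalize hirr.ne_zero
    · exact Multiset.mem_of_le (roots.le_of_dvd (hp.map _).ne_zero
        (Polynomial.map_dvd _ (UniqueFactorizationMonoid.dvd_of_mem_normalizedFactors hq))) hz
  refine ⟨F.filter (· ≠ X), F.count X, ?_, fun q hq => ?_, hF.symm ▸ hmem, hF.symm ▸ hprod⟩
  · rw [count_roots, le_rootMultiplicity_iff (hp.map _).ne_zero, C_0, sub_zero, X_pow_dvd_iff] at h0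
    have hX : X ^ 2 ∣ p := X_pow_dvd_iff.2 fun d hd => by simpa using h0 d hd
    rw [UniqueFactorizationMonoid.dvd_iff_normalizedFactors_le_normalizedFactors
      (pow_ne_zero 2 X_ne_zero) hp.ne_zero, UniqueFactorizationMonoid.normalizedFactors_pow,
      UniqueFactorizationMonoid.normalizedFactors_irreducible irreducible_X,
      monic_X.normalize_eq_self, Multiset.nsmul_singleton] at hX
    exact Multiset.le_count_iff_replicate_le.2 hX
  · obtain ⟨hqF, hqX⟩ := Multiset.mem_filter.1 hq
    obtain ⟨h1, h2, h3⟩ := hmem q hqF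
    exact (eq_X_or_natDegree_eq_two h1 h2 h3).resolve_left hqX

/-- Corollary 20: if `A ∈ Q(P)` has all eigenvalues with zero real part, at least two
zero eigenvalues, and the nSSP, then `P` is an inertially arbitrary pattern. -/
theorem inertially_arbitrary (n : ℕ) (P : Fin n → Fin n → SignType)
    (A : Matrix (Fin n) (Fin n) ℝ) (hA : qMem P A)
    (hre : ∀ z ∈ (A.map (algebraMap ℝ ℂ)).charpoly.roots, z.re = 0)
    (h0 : 2 ≤ (A.map (algebraMap ℝ ℂ)).charpoly.roots.count 0)
    (hnssp : HasNSSP A) :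
    ∀ np nm nz : ℕ, np + nm + nz = n →
      ∃ B : Matrix (Fin n) (Fin n) ℝ, qMem P B ∧
        ((B.map (algebraMap ℝ ℂ)).charpoly.roots.filter (fun z => 0 < z.re)).card = np ∧
        ((B.map (algebraMap ℝ ℂ)).charpoly.roots.filter (fun z => z.re < 0)).card = nm ∧
        ((B.map (algebraMap ℝ ℂ)).charpoly.roots.filter (fun z => z.re = 0)).card = nz := by
  intro np nm nz hn
  rw [charpoly_map] at hre h0
  obtain ⟨Q, m, hm, hQ, hfac, hprod⟩ :=
    exists_quadratic_factorization (charpoly_monic A) hre h0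
  have hdeg : np + nm + nz = m + 2 * Q.card := by
    rw [hn, ← Fintype.card_fin n, ← charpoly_natDegree_eq_dim A, ← hprod,
      natDegree_multiset_prod_of_monic _ fun q hq => (hfac q hq).2.1, Multiset.map_add,
      Multiset.map_congr rfl hQ]
    simp [add_comm, mul_comm]
  obtain ⟨T, hT, hnp, hnm, hnz⟩ := exists_sign_assignment Q hQ hm hdeg
  have hTfac (x) (hx : x ∈ T) := hfac x.1 (hT ▸ Multiset.mem_map_of_mem Prod.fst hx)
  obtain ⟨N, hN⟩ := exists_charpoly_add_smul T A.toLin'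
    (fun x hx => ⟨(hTfac x hx).1, (hTfac x hx).2.1⟩)
    (by rw [charpoly_toLin', hT, hprod])
  have hlim : Filter.Tendsto (fun ε : ℝ => A + ε • LinearMap.toMatrix' N)
      (nhdsWithin 0 (Set.Ioi 0)) (nhds A) := by
    have : Continuous fun ε : ℝ => A + ε • LinearMap.toMatrix' N := by fun_prop
    simpa using (this.tendsto 0).mono_left nhdsWithin_le_nhds
  obtain ⟨ε, ⟨B, hB, hBM⟩, hε⟩ :=
    ((hlim.eventually (hnssp.eventually_exists_charpoly_eq hA)).and
      self_mem_nhdsWithin).exists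
  have hchar : B.charpoly = (T.map fun x => x.1.comp (X - C (ε * x.2))).prod := by
    rw [hBM, ← hN ε, ← charpoly_toLin']
    simp
  have hcount (p : ℝ → Prop) [DecidablePred p] :=
    card_filter_roots_prod_comp T ε (fun x hx => (hTfac x hx).2.1) (fun x hx => (hTfac x hx).2.2) p
  refine ⟨B, hB, ?_, ?_, ?_⟩ <;> rw [charpoly_map, hchar]
  · rw [hcount fun r => 0 < r]
    simpa only [mul_pos_iff_of_pos_left hε] using hnp
  · rw [hcount fun r => r < 0]
    simpa only [mul_neg_iff, hε, hε.not_gt, true_and, false_and, or_false] using hnm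
  · rw [hcount fun r => r = 0]
    simpa only [mul_eq_zero, hε.ne', false_or] using hnz
end
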